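/- There exist absolute constants c > 0 and C > 0 such that the following holds. Let p be a prime, let X > 0 be an integer, and let Y ⊆ F_p. For each y ∈ Y let X_y ⊆ F_p with |X_y| ≤ X, and let Z = ⋃_{y ∈ Y} X_y × {y} ⊆ F_p^2. Let L be a set of affine lines in F_p^2, and suppose |Y|·|L| ≤ c·p^2. Then I(Z, L) ≤ C·( min(|Y|^{9/10} X^{3/5} |L|^{7/10}, |Y|^{7/9} X^{5/9} |L|^{7/9}) + |Y| X^{1/2} |L|^{1/2} + |Z|^{2/3}|L|^{2/3} + |L| + |Z| ). -/

import Mathlib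

/-- `ℓ ⊆ F^2` is an affine line if it is given by an equation `a x + b y = c`
with `(a, b) ≠ (0, 0)`. -/
def IsLine {F : Type*} [Field F] (ℓ : Set (F × F)) : Prop :=
  ∃ a b c : F, (a ≠ 0 ∨ b ≠ 0) ∧ ℓ = {z : F × F | a * z.1 + b * z.2 = c}

/-- `nIncidences P L` is `I(P, L)`, the number of pairs `(z, ℓ) ∈ P × L` with `z ∈ ℓ`. -/
noncomputable def nIncidences {F : Type*} (P : Set (F × F)) (L : Set (Set (F × F))) : ℕ :=
  {zl : (F × F) × Set (F × F) | zl.1 ∈ P ∧ zl.2 ∈ L ∧ zl.1 ∈ zl.2}.ncard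

/-- A light ray in `K^3`: a line with direction `(1, s, s^2)` through `(0, u, v)`. -/
@[ext]
structure LightRay (K : Type*) where
  /-- the slope, which determines the direction `(1, s, s^2)` -/
  s : K
  /-- the second coordinate of the base point -/
  u : K
  /-- the third coordinate of the base point -/
  v : K

namespace LightRay

section

open MvPolynomial

variable {K : Type*} [Field K]

/-- The point of a light ray with parameter `t`. -/
def pt (r : LightRay K) (t : K) : Fin 3 → K := ![t, r.u + t * r.s, r.v + t * r.s ^ 2]

/-- The restriction of a polynomial to a light ray, as a polynomial in the parameter. -/
noncomputable def restr (r : LightRay K) : MvPolynomial (Fin 3) K →ₐ[K] Polynomial K :=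
  aeval ![Polynomial.X, Polynomial.C r.u + Polynomial.X * Polynomial.C r.s,
    Polynomial.C r.v + Polynomial.X * Polynomial.C (r.s ^ 2)]

/-- `r` lies on the zero set of `f`. -/
def Lies (f : MvPolynomial (Fin 3) K) (r : LightRay K) : Prop := r.restr f = 0

/-- Two light rays have a common point. -/
def Meet (r₁ r₂ : LightRay K) : Prop := ∃ t, r₁.pt t = r₂.pt t

@[simp] theorem pt_zero (r : LightRay K) (t : K) : r.pt t 0 = t := rfl
@[simp] theorem pt_one (r : LightRay K) (t : K) : r.pt t 1 = r.u + t * r.s := rfl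
@[simp] theorem pt_two (r : LightRay K) (t : K) : r.pt t 2 = r.v + t * r.s ^ 2 := rfl

@[simp] theorem restr_X_zero (r : LightRay K) : r.restr (X 0) = Polynomial.X := by simp [restr]
@[simp] theorem restr_X_one (r : LightRay K) :
    r.restr (X 1) = Polynomial.C r.u + Polynomial.X * Polynomial.C r.s := by simp [restr]
@[simp] theorem restr_X_two (r : LightRay K) :
    r.restr (X 2) = Polynomial.C r.v + Polynomial.X * Polynomial.C (r.s ^ 2) := by simp [restr]
@[simp] theorem restr_C (r : LightRay K) (a : K) : r.restr (C a) = Polynomial.C a := by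
  simp [restr, Polynomial.algebraMap_eq]

theorem eval_restr (r : LightRay K) (f : MvPolynomial (Fin 3) K) (t : K) :
    (r.restr f).eval t = eval (r.pt t) f := by
  induction f using MvPolynomial.induction_on with
  | C a => simp
  | add p q hp hq => simp [hp, hq]
  | mul_X p i hp =>
    rw [map_mul, Polynomial.eval_mul, hp, map_mul, eval_X]
    fin_cases i <;> simp
    exact Or.inl (mul_comm _ _)

theorem natDegree_restr_le (r : LightRay K) (f : MvPolynomial (Fin 3) K) :
    (r.restr f).natDegree ≤ f.totalDegree := by
  have := MvPolynomial.aeval_natDegree_le (n := 1) f le_rfl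
    ![Polynomial.X, Polynomial.C r.u + Polynomial.X * Polynomial.C r.s,
    Polynomial.C r.v + Polynomial.X * Polynomial.C (r.s ^ 2)] (by
      intro i
      fin_cases i
      · simp
      · simp only [Fin.mk_one, Fin.isValue, Matrix.cons_val_one, Matrix.cons_val_zero]
        compute_degree
      · simp only [Fin.reduceFinMk, Matrix.cons_val]
        compute_degree)
  simpa [restr] using this

theorem lies_iff_eval [Infinite K] {r : LightRay K} {f : MvPolynomial (Fin 3) K} :
    Lies f r ↔ ∀ t, eval (r.pt t) f = 0 := by
  simp only [← eval_restr]
  exact ⟨fun h t => by rw [h]; simp, fun h => Polynomial.funext (by simpa using h)⟩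

theorem Lies.eval {r : LightRay K} {f : MvPolynomial (Fin 3) K} (h : Lies f r) (t : K) :
    eval (r.pt t) f = 0 := by
  rw [← eval_restr, h, Polynomial.eval_zero]

theorem lies_mul {r : LightRay K} {f g : MvPolynomial (Fin 3) K} :
    Lies (f * g) r ↔ Lies f r ∨ Lies g r := by
  simp [Lies]

theorem Lies.of_dvd {r : LightRay K} {f g : MvPolynomial (Fin 3) K} (h : Lies f r) (hd : f ∣ g) :
    Lies g r := by
  obtain ⟨k, rfl⟩ := hd
  exact lies_mul.2 (Or.inl h)

theorem Meet.symm {r₁ r₂ : LightRay K} (h : Meet r₁ r₂) : Meet r₂ r₁ := by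
  obtain ⟨t, h⟩ := h
  exact ⟨t, h.symm⟩

/-- A light ray not lying on `h` meets at most `deg h` pairwise disjoint light rays at zeros
of `h`. -/
theorem card_meet_le {h : MvPolynomial (Fin 3) K} {r : LightRay K} (hr : ¬ Lies h r)
    (B : Finset (LightRay K))
    (hB : ∀ r₁ ∈ B, ∀ r₂ ∈ B, Meet r₁ r₂ → r₁ = r₂)
    (hz : ∀ r' ∈ B, ∃ t, r.pt t = r'.pt t ∧ eval (r.pt t) h = 0) :
    B.card ≤ h.totalDegree := by
  classical
  choose! t ht hzt using hz
  calc B.card = (B.image t).card := by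
        rw [Finset.card_image_of_injOn]
        intro r₁ h₁ r₂ h₂ he
        refine hB r₁ h₁ r₂ h₂ ⟨t r₁, ?_⟩
        rw [← ht r₁ h₁, he, ht r₂ h₂]
    _ ≤ (r.restr h).roots.toFinset.card := by
        refine Finset.card_le_card fun x hx => ?_
        obtain ⟨r', hr', rfl⟩ := Finset.mem_image.1 hx
        rw [Multiset.mem_toFinset, Polynomial.mem_roots hr, Polynomial.IsRoot, eval_restr]
        exact hzt r' hr'
    _ ≤ (r.restr h).natDegree :=
        (Multiset.toFinset_card_le _).trans (Polynomial.card_roots' _)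
    _ ≤ h.totalDegree := natDegree_restr_le r h

theorem card_exponents (n : ℕ) :
    Nat.card {s : Fin 3 →₀ ℕ | (s.sum fun _ e => e) ≤ n} = (n + 3).choose 3 := by
  classical
  have key (n : ℕ) : {s : Fin 3 →₀ ℕ | (s.sum fun _ e => e) ≤ n} =
      (((Finset.range (n + 1)).biUnion fun i =>
        Finset.finsuppAntidiag Finset.univ i : Finset (Fin 3 →₀ ℕ)) : Set (Fin 3 →₀ ℕ)) := by
    ext s
    simp [Finsupp.sum_fintype]
  rw [key, Nat.card_coe_set_eq, Set.ncard_coe_finset, Finset.card_biUnion]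
  · simp only [Finset.card_finsuppAntidiag_nat_eq_choose]
    induction n with
    | zero => simp
    | succ n ih =>
      rw [Finset.sum_range_succ, ih]
      simp only [Finset.card_univ, Fintype.card_fin]
      rw [show n + 1 + 3 = (n + 3) + 1 by ring, Nat.choose_succ_succ' (n + 3) 2,
        show 3 + (n + 1) - 1 = n + 3 by omega,
        show (n + 3).choose (n + 1) = (n + 3).choose 2 from
          (Nat.choose_symm_of_eq_add (show n + 3 = 2 + (n + 1) by ring)).symm]
      ring
  · intro i _ j _ hij
    rw [Function.onFun, Finset.disjoint_left]
    intro s hs hs'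
    simp only [Finset.mem_finsuppAntidiag] at hs hs'
    exact hij (hs.1.symm.trans hs'.1)

theorem finrank_restrictTotalDegree (n : ℕ) :
    Module.finrank K (restrictTotalDegree (Fin 3) K n) = (n + 3).choose 3 := by
  rw [← card_exponents n]
  exact Module.finrank_eq_nat_card_basis (basisRestrictSupport K _)

/-- Few light rays lie on a common surface of small degree. -/
theorem exists_lies (B : Finset (LightRay K)) (d : ℕ) (hd : 6 * B.card < (d + 2) * (d + 3)) :
    ∃ f : MvPolynomial (Fin 3) K, f ≠ 0 ∧ f.totalDegree ≤ d ∧ ∀ r ∈ B, Lies f r := by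
  let φ : restrictTotalDegree (Fin 3) K d →ₗ[K] (B → Polynomial.degreeLT K (d + 1)) :=
    LinearMap.pi fun r => (r.1.restr.toLinearMap.comp (Submodule.subtype _)).codRestrict _ (by
      rintro ⟨f, hf⟩
      rw [mem_restrictTotalDegree] at hf
      rw [Polynomial.mem_degreeLT]
      refine (Polynomial.degree_le_natDegree).trans_lt ?_
      exact_mod_cast Nat.lt_succ_of_le ((natDegree_restr_le r.1 f).trans hf))
  have hfr : Module.finrank K (Polynomial.degreeLT K (d + 1)) = d + 1 := by
    rw [(Polynomial.degreeLTEquiv K (d + 1)).finrank_eq]; simp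
  have : Module.Finite K (Polynomial.degreeLT K (d + 1)) :=
    Module.finite_of_finrank_pos (by omega)
  have hk : LinearMap.ker φ ≠ ⊥ := by
    apply LinearMap.ker_ne_bot_of_finrank_lt
    rw [finrank_restrictTotalDegree, Module.finrank_pi_fintype]
    simp only [hfr, Finset.sum_const, Finset.card_univ, Fintype.card_coe, smul_eq_mul]
    have h6 : 6 * (d + 3).choose 3 = (d + 3) * (d + 2) * (d + 1) := by
      have := Nat.descFactorial_eq_factorial_mul_choose (d + 3) 3
      simp only [Nat.descFactorial, Nat.factorial] at this
      simp at this
      rw [← this]; ring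
    nlinarith
  obtain ⟨⟨f, hf⟩, hfk, hf0⟩ := (Submodule.ne_bot_iff _).1 hk
  refine ⟨f, fun h => hf0 (Subtype.ext h), (mem_restrictTotalDegree _ _ _).1 hf, fun r hr => ?_⟩
  have := congrFun (LinearMap.mem_ker.1 hfk) ⟨r, hr⟩
  exact congrArg Subtype.val this

end

section

open MvPolynomial

variable {K : Type*} [Field K]

theorem six_mul_choose_three (k : ℕ) : 6 * (k + 3).choose 3 = (k + 3) * (k + 2) * (k + 1) := by
  have := Nat.descFactorial_eq_factorial_mul_choose (k + 3) 3
  simp only [Nat.descFactorial, Nat.factorial] at this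
  simp at this
  rw [← this]; ring

theorem exists_linear_form {r r' : LightRay K} (h : r ≠ r') :
    ∃ f : MvPolynomial (Fin 3) K, f.totalDegree ≤ 1 ∧ Lies f r' ∧ ¬ Lies f r := by
  have hdeg (i : Fin 3) (a b : K) : (X i - C a - C b * X 0).totalDegree ≤ 1 := by
    refine (totalDegree_sub _ _).trans (max_le ((totalDegree_sub _ _).trans ?_)
      ((totalDegree_mul _ _).trans ?_))
    · simp
    · simp
  by_cases hs : r.s = r'.s ∧ r.u = r'.u
  · refine ⟨X 2 - C r'.v - C (r'.s ^ 2) * X 0, hdeg _ _ _, ?_, fun hl => h ?_⟩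
    · simp only [Lies, map_sub, map_mul, restr_X_two, restr_X_zero, restr_C]
      ring
    · ext
      · exact hs.1
      · exact hs.2
      · have := congrArg (Polynomial.coeff · 0) hl
        simpa [sub_eq_zero] using this
  · refine ⟨X 1 - C r'.u - C r'.s * X 0, hdeg _ _ _, ?_, fun hl => hs ⟨?_, ?_⟩⟩
    · simp only [Lies, map_sub, map_mul, restr_X_one, restr_X_zero, restr_C]
      ring
    · have := congrArg (Polynomial.coeff · 1) hl
      simpa [sub_eq_zero, Polynomial.coeff_C] using this
    · have := congrArg (Polynomial.coeff · 0) hl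
      simpa [sub_eq_zero] using this

theorem exists_separating (M : Finset (LightRay K)) (r : LightRay K) (hr : r ∈ M) :
    ∃ f : MvPolynomial (Fin 3) K, f.totalDegree + 1 ≤ M.card ∧ ¬ Lies f r ∧
      ∀ r' ∈ M, r' ≠ r → Lies f r' := by
  classical
  choose! f hf using fun (r' : LightRay K) (h : r ≠ r') => exists_linear_form h
  refine ⟨∏ r' ∈ M.erase r, f r', ?_, ?_, fun r' hr' hne => ?_⟩
  · have : (∏ r' ∈ M.erase r, f r').totalDegree ≤ (M.erase r).card := by
      refine (totalDegree_finsetProd _ _).trans ?_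
      refine (Finset.sum_le_sum (g := fun _ => 1) fun r' hr' => ?_).trans (by simp)
      exact (hf r' (Finset.ne_of_mem_erase hr').symm).1
    have := Finset.card_erase_add_one hr
    omega
  · rw [Lies, map_prod, Finset.prod_eq_zero_iff]
    rintro ⟨r', hr', h⟩
    exact (hf r' (Finset.ne_of_mem_erase hr').symm).2.2 h
  · exact ((hf r' hne.symm).2.1).of_dvd (Finset.dvd_prod_of_mem _ (by simp [hne, hr']))

theorem restr_aeval_X_zero (r : LightRay K) (q : Polynomial K) :
    r.restr (Polynomial.aeval (X 0) q) = q := by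
  rw [← Polynomial.aeval_algHom_apply, restr_X_zero, Polynomial.aeval_X_left_apply]

theorem totalDegree_aeval_X_le (q : Polynomial K) :
    (Polynomial.aeval (X 0 : MvPolynomial (Fin 3) K) q).totalDegree ≤ q.natDegree := by
  rw [Polynomial.aeval_eq_sum_range]
  refine totalDegree_finsetSum_le fun i hi => (totalDegree_smul_le _ _).trans ?_
  rw [totalDegree_X_pow]
  exact Nat.lt_succ_iff.1 (Finset.mem_range.1 hi)

/-- A Bezout inequality: an irreducible surface `g = 0` and a surface `h = 0` not containing it
share at most `deg g * deg h` light rays. -/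
theorem card_le_of_not_dvd {g h : MvPolynomial (Fin 3) K} (hg : Irreducible g) (hgh : ¬ g ∣ h)
    (M : Finset (LightRay K)) (hMg : ∀ r ∈ M, Lies g r) (hMh : ∀ r ∈ M, Lies h r) :
    M.card ≤ g.totalDegree * h.totalDegree := by
  classical
  by_contra! hlt
  set e := g.totalDegree with he
  set e' := h.totalDegree with he'
  set m := M.card with hm
  have hg0 := hg.ne_zero
  have hh0 : h ≠ 0 := by rintro rfl; exact hgh (dvd_zero _)
  choose! P hPdeg hPr hPl using exists_separating M
  let Θ : (M → Polynomial.degreeLT K (m ^ 2 + e + e' + 2)) ×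
      restrictTotalDegree (Fin 3) K (m ^ 2 + m + e') ×
      restrictTotalDegree (Fin 3) K (m ^ 2 + m + e) →ₗ[K]
      MvPolynomial (Fin 3) K :=
    LinearMap.coprod (∑ r : M, (LinearMap.mulLeft K (P r)).comp
        ((Polynomial.aeval (X 0)).toLinearMap.comp ((Submodule.subtype _).comp (LinearMap.proj r))))
      (LinearMap.coprod ((LinearMap.mulLeft K g).comp (Submodule.subtype _))
        ((LinearMap.mulLeft K h).comp (Submodule.subtype _)))
  have hΘ (x) : Θ x = ∑ r : M, P r * Polynomial.aeval (X 0) (x.1 r : Polynomial K) +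
      (g * x.2.1 + h * x.2.2) := by
    simp [Θ]
  have hrange (x) : Θ x ∈ restrictTotalDegree (Fin 3) K (m ^ 2 + m + e + e') := by
    rw [hΘ, mem_restrictTotalDegree]
    refine (totalDegree_add _ _).trans (max_le ?_ ((totalDegree_add _ _).trans (max_le ?_ ?_)))
    · refine totalDegree_finsetSum_le fun r _ => (totalDegree_mul _ _).trans ?_
      have h1 := hPdeg r.1 r.2
      have h2 := totalDegree_aeval_X_le (x.1 r : Polynomial K)
      have h3 : (x.1 r : Polynomial K).natDegree < m ^ 2 + e + e' + 2 := by
        by_cases h0 : (x.1 r : Polynomial K) = 0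
        · simp [h0]
        · exact (Polynomial.natDegree_lt_iff_degree_lt h0).2 (Polynomial.mem_degreeLT.1 (x.1 r).2)
      omega
    · have := (mem_restrictTotalDegree _ _ _).1 x.2.1.2
      have := totalDegree_mul g (x.2.1 : MvPolynomial (Fin 3) K)
      omega
    · have := (mem_restrictTotalDegree _ _ _).1 x.2.2.2
      have := totalDegree_mul h (x.2.2 : MvPolynomial (Fin 3) K)
      omega
  let Ψ : restrictTotalDegree (Fin 3) K (m ^ 2 + m) →ₗ[K]
      MvPolynomial (Fin 3) K × MvPolynomial (Fin 3) K :=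
    LinearMap.prod ((LinearMap.mulLeft K (-h)).comp (Submodule.subtype _))
      ((LinearMap.mulLeft K g).comp (Submodule.subtype _))
  have hker (x) (hx : Θ x = 0) : x.1 = 0 ∧
      ((x.2.1 : MvPolynomial (Fin 3) K), (x.2.2 : MvPolynomial (Fin 3) K)) ∈ LinearMap.range Ψ := by
    rw [hΘ] at hx
    have h0 : x.1 = 0 := by
      ext1 r
      have hr := congrArg (r.1.restr) hx
      rw [map_add, map_add, map_mul, map_mul, hMg r.1 r.2, hMh r.1 r.2, map_sum,
        Finset.sum_eq_single r] at hr
      · rw [map_mul, restr_aeval_X_zero] at hr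
        have hP := hPr r.1 r.2
        rw [Lies] at hP
        simp only [zero_mul, add_zero, map_zero, mul_eq_zero, hP, false_or] at hr
        exact Subtype.ext hr
      · intro r' _ hne
        rw [map_mul, hPl r'.1 r'.2 r.1 r.2 (fun hh => hne (Subtype.ext hh.symm)), zero_mul]
      · simp
    refine ⟨h0, ?_⟩
    simp only [h0, Pi.zero_apply, ZeroMemClass.coe_zero, map_zero, mul_zero,
      Finset.sum_const_zero, zero_add] at hx
    obtain ⟨c, hc⟩ : g ∣ (x.2.2 : MvPolynomial (Fin 3) K) := by
      refine (hg.prime.dvd_or_dvd (?_ : g ∣ h * x.2.2)).resolve_left hgh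
      exact ⟨-x.2.1, by linear_combination hx⟩
    have ha : (x.2.1 : MvPolynomial (Fin 3) K) = -h * c := by
      apply mul_left_cancel₀ hg0
      rw [hc] at hx
      linear_combination hx
    have hcd : c.totalDegree ≤ m ^ 2 + m := by
      by_cases hc0 : c = 0
      · simp [hc0]
      have := (mem_restrictTotalDegree _ _ _).1 x.2.2.2
      rw [hc, totalDegree_mul_of_isDomain hg0 hc0] at this
      omega
    exact ⟨⟨c, (mem_restrictTotalDegree _ _ _).2 hcd⟩, by simp [Ψ, ha, hc]⟩
  have hn := LinearMap.finrank_range_add_finrank_ker Θ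
  have h1 : Module.finrank K (LinearMap.range Θ) ≤ (m ^ 2 + m + e + e' + 3).choose 3 := by
    rw [← finrank_restrictTotalDegree (K := K)]
    refine Submodule.finrank_mono ?_
    rintro _ ⟨x, rfl⟩
    exact hrange x
  have h2 : Module.finrank K (LinearMap.ker Θ) ≤ (m ^ 2 + m + 3).choose 3 := by
    rw [← finrank_restrictTotalDegree (K := K)]
    refine le_trans ?_ (LinearMap.finrank_range_le Ψ)
    let ι : LinearMap.ker Θ →ₗ[K] LinearMap.range Ψ :=
      ((LinearMap.prodMap (Submodule.subtype _) (Submodule.subtype _)).comp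
        ((LinearMap.snd _ _ _).comp (Submodule.subtype _))).codRestrict _
        fun x => (hker x.1 x.2).2
    refine LinearMap.finrank_le_finrank_of_injective (f := ι) ?_
    intro x y hxy
    have h3 := congrArg Subtype.val hxy
    refine Subtype.ext (Prod.ext ((hker x.1 x.2).1.trans (hker y.1 y.2).1.symm)
      (Prod.ext (Subtype.ext ?_) (Subtype.ext ?_)))
    · exact congrArg Prod.fst h3
    · exact congrArg Prod.snd h3
  have hfr : Module.finrank K (Polynomial.degreeLT K (m ^ 2 + e + e' + 2)) =
      m ^ 2 + e + e' + 2 := by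
    rw [(Polynomial.degreeLTEquiv K _).finrank_eq]; simp
  have : Module.Finite K (Polynomial.degreeLT K (m ^ 2 + e + e' + 2)) :=
    Module.finite_of_finrank_pos (by omega)
  rw [Module.finrank_prod, Module.finrank_prod, Module.finrank_pi_fintype,
    finrank_restrictTotalDegree, finrank_restrictTotalDegree] at hn
  simp only [hfr, Finset.sum_const, Finset.card_univ, Fintype.card_coe, smul_eq_mul, ← hm] at hn
  have c1 := six_mul_choose_three (m ^ 2 + m + e + e')
  have c2 := six_mul_choose_three (m ^ 2 + m)
  have c3 := six_mul_choose_three (m ^ 2 + m + e')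
  have c4 := six_mul_choose_three (m ^ 2 + m + e)
  have hfin : m * (m ^ 2 + e + e' + 2) * 6 + ((m ^ 2 + m + e') + 3) * ((m ^ 2 + m + e') + 2)
      * ((m ^ 2 + m + e') + 1) + ((m ^ 2 + m + e) + 3) * ((m ^ 2 + m + e) + 2)
      * ((m ^ 2 + m + e) + 1) ≤ (m ^ 2 + m + e + e' + 3) * (m ^ 2 + m + e + e' + 2) *
      (m ^ 2 + m + e + e' + 1) + (m ^ 2 + m + 3) * (m ^ 2 + m + 2) * (m ^ 2 + m + 1) := by
    omega
  have hfin2 : m * (m ^ 2 + e + e' + 2) ≤ e * e' * (m ^ 2 + m + e + e' + 2) := by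
    zify at hfin ⊢
    have : (0 : ℤ) ≤ e * e' * (e + e') := by positivity
    nlinarith
  have hfin3 : (e * e' + 1) * (m ^ 2 + m + e + e' + 2) ≤ m * (m ^ 2 + m + e + e' + 2) :=
    Nat.mul_le_mul_right _ hlt
  nlinarith
end

section

open MvPolynomial

variable {K : Type*} [Field K]

theorem pderiv_pderiv_comm (i j : Fin 3) (f : MvPolynomial (Fin 3) K) :
    pderiv i (pderiv j f) = pderiv j (pderiv i f) := by
  by_cases hij : i = j
  · rw [hij]
  ext m
  simp only [coeff_pderiv, Finsupp.add_apply, Finsupp.single_eq_of_ne hij,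
    Finsupp.single_eq_of_ne (Ne.symm hij)]
  rw [add_right_comm]
  push_cast
  ring

theorem totalDegree_pderiv_succ_le {i : Fin 3} {f : MvPolynomial (Fin 3) K}
    (h : pderiv i f ≠ 0) : (pderiv i f).totalDegree + 1 ≤ f.totalDegree := by
  obtain ⟨m, hm, hd⟩ := Finset.exists_mem_eq_sup _ (support_nonempty.2 h)
    (fun s : Fin 3 →₀ ℕ => s.sum fun _ e => e)
  have hc : coeff (m + Finsupp.single i 1) f ≠ 0 := by
    rw [mem_support_iff, coeff_pderiv] at hm
    exact left_ne_zero_of_mul hm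
  have := le_totalDegree (mem_support_iff.2 hc)
  rw [Finsupp.sum_add_index' (by simp) (by simp), Finsupp.sum_single_index rfl] at this
  rw [totalDegree, hd]
  exact this

theorem totalDegree_pderiv_le (i : Fin 3) (f : MvPolynomial (Fin 3) K) :
    (pderiv i f).totalDegree ≤ f.totalDegree := by
  by_cases h : pderiv i f = 0
  · simp [h]
  · exact (Nat.le_succ _).trans (totalDegree_pderiv_succ_le h)

theorem exists_pderiv_ne_zero {p : ℕ} [Fact p.Prime] [CharP K p] {f : MvPolynomial (Fin 3) K}
    (hd : 0 < f.totalDegree) (hp : f.totalDegree < p) : ∃ i, pderiv i f ≠ 0 := by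
  have hf : f ≠ 0 := by rintro rfl; simp at hd
  obtain ⟨m, hm, hd'⟩ := Finset.exists_mem_eq_sup _ (support_nonempty.2 hf)
    (fun s : Fin 3 →₀ ℕ => s.sum fun _ e => e)
  rw [totalDegree, hd', Finsupp.sum_fintype _ _ (by simp)] at hd hp
  obtain ⟨i, hi, hi0⟩ := Finset.exists_ne_zero_of_sum_ne_zero hd.ne'
  refine ⟨i, fun h0 => ?_⟩
  have hc := congrArg (coeff (m - Finsupp.single i 1)) h0
  have hle : Finsupp.single i 1 ≤ m := by
    simpa [Finsupp.single_le_iff] using Nat.one_le_iff_ne_zero.2 hi0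
  rw [coeff_pderiv, tsub_add_cancel_of_le hle, coeff_zero, mul_eq_zero] at hc
  refine hc.elim (mem_support_iff.1 hm) fun hc => ?_
  have h1 : ((m i : ℕ) : K) = 0 := by
    rw [← hc]
    simp only [Finsupp.tsub_apply, Finsupp.single_eq_same]
    rw [← Nat.cast_one (R := K), ← Nat.cast_add, Nat.sub_add_cancel (by omega)]
  rw [CharP.cast_eq_zero_iff K p] at h1
  have := Nat.le_of_dvd (by omega) h1
  have := Finset.single_le_sum (f := fun i => m i) (fun _ _ => Nat.zero_le _) hi
  omega

/-- The derivative in direction `(1, s, s^2)`. -/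
noncomputable def dirD (s : K) (f : MvPolynomial (Fin 3) K) : MvPolynomial (Fin 3) K :=
  pderiv 0 f + C s * pderiv 1 f + C (s ^ 2) * pderiv 2 f

theorem derivative_restr (r : LightRay K) (f : MvPolynomial (Fin 3) K) :
    Polynomial.derivative (r.restr f) = r.restr (dirD r.s f) := by
  induction f using MvPolynomial.induction_on with
  | C a => simp [dirD]
  | add p q hp hq =>
    rw [map_add, map_add, hp, hq, ← map_add]
    congr 1
    simp only [dirD, map_add]
    ring
  | mul_X p i hp =>
    have hX : Polynomial.derivative (r.restr (X i)) = r.restr (dirD r.s (X i)) := by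
      fin_cases i <;> simp [dirD, pderiv_X, Polynomial.derivative_pow]
    rw [map_mul, Polynomial.derivative_mul, hp, hX, ← map_mul, ← map_mul, ← map_add]
    congr 1
    simp only [dirD, pderiv_mul]
    ring

theorem eq_zero_of_ode {p : ℕ} [Fact p.Prime] [CharP K p] {G a b c : Polynomial K} {x : K}
    (hG : G.natDegree < p)
    (hode : a * Polynomial.derivative (Polynomial.derivative G) =
      c * Polynomial.derivative G + b * G)
    (h0 : G.eval x = 0) (h1 : (Polynomial.derivative G).eval x = 0) (ha : a.eval x ≠ 0) :
    G = 0 := by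
  by_contra hne
  obtain ⟨n, H, hGH, hH⟩ : ∃ (n : ℕ) (H : Polynomial K),
      G = (Polynomial.X - Polynomial.C x) ^ n * H ∧ H.eval x ≠ 0 := by
    obtain ⟨H, h, h'⟩ := Polynomial.exists_eq_pow_rootMultiplicity_mul_and_not_dvd G hne x
    exact ⟨_, H, h, fun hh => h' (Polynomial.dvd_iff_isRoot.2 hh)⟩
  have hnp : n < p := by
    refine lt_of_le_of_lt ?_ hG
    have hH0 : H ≠ 0 := by rintro rfl; simp at hH
    rw [hGH, Polynomial.natDegree_mul (pow_ne_zero _ (Polynomial.X_sub_C_ne_zero x)) hH0,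
      Polynomial.natDegree_pow, Polynomial.natDegree_X_sub_C]
    omega
  match n with
  | 0 => simp [hGH] at h0; exact hH h0
  | 1 => simp [hGH] at h1; exact hH h1
  | k + 2 =>
    set W := Polynomial.X - Polynomial.C x with hW
    have hW0 : W ≠ 0 := Polynomial.X_sub_C_ne_zero x
    have dW : Polynomial.derivative W = 1 := by simp [hW]
    have key : W ^ k * (a * (Polynomial.C ((k + 2 : ℕ) * (k + 1 : ℕ) : K) * H)) =
        W ^ k * (W * (c * (Polynomial.C ((k + 2 : ℕ) : K) * H + W * Polynomial.derivative H)
          + b * W * H - a * (2 * Polynomial.C ((k + 2 : ℕ) : K) * Polynomial.derivative H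
            + W * Polynomial.derivative (Polynomial.derivative H)))) := by
      rw [hGH] at hode
      simp only [Polynomial.derivative_mul, Polynomial.derivative_pow, dW,
        Polynomial.derivative_add, Polynomial.derivative_C, Polynomial.derivative_one,
        Polynomial.C_mul] at hode ⊢
      simp only [show k + 2 - 1 = k + 1 by omega, Nat.add_sub_cancel] at hode
      linear_combination hode
    have := congrArg (Polynomial.eval x) (mul_left_cancel₀ (pow_ne_zero k hW0) key)
    simp only [Polynomial.eval_mul, hW, Polynomial.eval_sub, Polynomial.eval_X, Polynomial.eval_C,
      sub_self, zero_mul, mul_eq_zero, ha, hH, or_false, false_or] at this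
    have hp (j : ℕ) (hj : j < p) (hj0 : 0 < j) : (j : K) ≠ 0 := fun h =>
      absurd (Nat.le_of_dvd hj0 ((CharP.cast_eq_zero_iff K p j).1 h)) (by omega)
    rcases this with h | h
    · exact hp _ (by omega) (by omega) h
    · exact hp _ (by omega) (by omega) h

variable (g : MvPolynomial (Fin 3) K)

/-- The discriminant of the direction form `∂₀ g + s ∂₁ g + s² ∂₂ g`. -/
noncomputable def disc : MvPolynomial (Fin 3) K :=
  pderiv 1 g ^ 2 - 4 * pderiv 2 g * pderiv 0 g

/-- The coefficient of `s` in the remainder of the second directional derivative modulo the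
first. -/
noncomputable def rem₁ : MvPolynomial (Fin 3) K :=
  pderiv 2 g ^ 3 * (2 * pderiv 0 (pderiv 1 g))
    - pderiv 2 g ^ 2 * pderiv 1 g * (pderiv 1 (pderiv 1 g) + 2 * pderiv 0 (pderiv 2 g))
    + pderiv 2 g * (pderiv 1 g ^ 2 - pderiv 2 g * pderiv 0 g) * (2 * pderiv 1 (pderiv 2 g))
    + (2 * pderiv 2 g * pderiv 1 g * pderiv 0 g - pderiv 1 g ^ 3) * pderiv 2 (pderiv 2 g)

/-- The constant coefficient of the remainder of the second directional derivative modulo the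
first. -/
noncomputable def rem₀ : MvPolynomial (Fin 3) K :=
  pderiv 2 g ^ 3 * pderiv 0 (pderiv 0 g)
    - pderiv 2 g ^ 2 * pderiv 0 g * (pderiv 1 (pderiv 1 g) + 2 * pderiv 0 (pderiv 2 g))
    + pderiv 2 g * pderiv 1 g * pderiv 0 g * (2 * pderiv 1 (pderiv 2 g))
    - pderiv 0 g * (pderiv 1 g ^ 2 - pderiv 2 g * pderiv 0 g) * pderiv 2 (pderiv 2 g)

theorem exists_dirD_identity (s : K) : ∃ R : MvPolynomial (Fin 3) K,
    pderiv 2 g ^ 3 * dirD s (dirD s g) = dirD s g * R + (rem₁ g * C s + rem₀ g) := by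
  refine ⟨pderiv 2 g ^ 2 * (pderiv 1 (pderiv 1 g) + 2 * pderiv 0 (pderiv 2 g))
    + pderiv 2 g * (2 * pderiv 1 (pderiv 2 g)) * (pderiv 2 g * C s - pderiv 1 g)
    + pderiv 2 (pderiv 2 g) * (pderiv 2 g ^ 2 * C s ^ 2 - pderiv 2 g * pderiv 1 g * C s
      + pderiv 1 g ^ 2 - pderiv 2 g * pderiv 0 g), ?_⟩
  simp only [dirD, rem₁, rem₀, map_add, pderiv_C_mul, pderiv_pderiv_comm 1 0,
    pderiv_pderiv_comm 2 0, pderiv_pderiv_comm 2 1]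
  simp only [C_pow]
  ring

variable {g}

theorem Lies.eval_dirD {r : LightRay K} (h : Lies g r) (t : K) :
    MvPolynomial.eval (r.pt t) (dirD r.s g) = 0 := by
  rw [← eval_restr, ← derivative_restr, h]
  simp

theorem Lies.lies_dirD {r : LightRay K} (h : Lies g r) : Lies (dirD r.s g) r := by
  rw [Lies, ← derivative_restr, h]
  simp

theorem eval_rem_eq_zero {r₁ r₂ : LightRay K} (h₁ : Lies g r₁) (h₂ : Lies g r₂)
    (hs : r₁.s ≠ r₂.s) {t : K} (ht : r₁.pt t = r₂.pt t) :
    eval (r₁.pt t) (rem₁ g) = 0 ∧ eval (r₁.pt t) (rem₀ g) = 0 := by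
  obtain ⟨R₁, e₁⟩ := exists_dirD_identity g r₁.s
  obtain ⟨R₂, e₂⟩ := exists_dirD_identity g r₂.s
  have e₁ := congrArg (eval (r₁.pt t)) e₁
  have e₂ := congrArg (eval (r₂.pt t)) e₂
  simp only [map_mul, h₁.lies_dirD.eval_dirD, h₂.lies_dirD.eval_dirD, h₁.eval_dirD, h₂.eval_dirD, map_add,
    eval_C, mul_zero, zero_mul, zero_add] at e₁ e₂
  rw [← ht] at e₂
  have : eval (r₁.pt t) (rem₁ g) * (r₁.s - r₂.s) = 0 := by linear_combination e₂ - e₁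
  have h0 := (mul_eq_zero.1 this).resolve_right (sub_ne_zero.2 hs)
  exact ⟨h0, by rw [h0] at e₁; linear_combination -e₁⟩

/-- A surface dividing both remainders is ruled by the light rays in the zero directions of its
direction form. -/
theorem lies_of_eval_dirD {p : ℕ} [Fact p.Prime] [CharP K p] (hp : g.totalDegree < p)
    (h₁ : g ∣ rem₁ g) (h₀ : g ∣ rem₀ g) {r : LightRay K} {t : K}
    (hg : eval (r.pt t) g = 0) (hd : eval (r.pt t) (dirD r.s g) = 0)
    (hA : eval (r.pt t) (pderiv 2 g) ≠ 0) : Lies g r := by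
  obtain ⟨R, e⟩ := exists_dirD_identity g r.s
  obtain ⟨k₁, hk₁⟩ := h₁
  obtain ⟨k₀, hk₀⟩ := h₀
  have e := congrArg r.restr e
  rw [hk₁, hk₀] at e
  refine eq_zero_of_ode (p := p) (x := t) (a := r.restr (pderiv 2 g ^ 3)) (c := r.restr R)
    (b := r.restr (k₁ * C r.s + k₀)) ((natDegree_restr_le r g).trans_lt hp) ?_ ?_ ?_ ?_
  · rw [derivative_restr, derivative_restr]
    simp only [map_mul, map_add] at e ⊢
    linear_combination e
  · rwa [eval_restr]
  · rwa [derivative_restr, eval_restr]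
  · rw [eval_restr, map_pow]
    exact pow_ne_zero _ hA

section degrees

theorem totalDegree_mul_le {a b : MvPolynomial (Fin 3) K} {m n : ℕ} (ha : a.totalDegree ≤ m)
    (hb : b.totalDegree ≤ n) : (a * b).totalDegree ≤ m + n :=
  (totalDegree_mul a b).trans (add_le_add ha hb)

theorem totalDegree_add_le {a b : MvPolynomial (Fin 3) K} {m : ℕ} (ha : a.totalDegree ≤ m)
    (hb : b.totalDegree ≤ m) : (a + b).totalDegree ≤ m :=
  (totalDegree_add a b).trans (max_le ha hb)

theorem totalDegree_sub_le {a b : MvPolynomial (Fin 3) K} {m : ℕ} (ha : a.totalDegree ≤ m)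
    (hb : b.totalDegree ≤ m) : (a - b).totalDegree ≤ m :=
  (totalDegree_sub a b).trans (max_le ha hb)

theorem totalDegree_two_mul_le {a : MvPolynomial (Fin 3) K} {m : ℕ} (ha : a.totalDegree ≤ m) :
    (2 * a).totalDegree ≤ m := by
  rw [two_mul]
  exact totalDegree_add_le ha ha

theorem totalDegree_mul_pderiv_pderiv_le {a : MvPolynomial (Fin 3) K} (i j : Fin 3)
    (ha : a.totalDegree ≤ 3 * g.totalDegree) :
    (a * pderiv i (pderiv j g)).totalDegree ≤ 4 * g.totalDegree := by
  have := totalDegree_mul_le ha ((totalDegree_pderiv_le i _).trans (totalDegree_pderiv_le j g))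
  omega

theorem totalDegree_cubic_le (i j k : Fin 3) :
    (pderiv i g * pderiv j g * pderiv k g).totalDegree ≤ 3 * g.totalDegree := by
  have := totalDegree_mul_le (totalDegree_mul_le (totalDegree_pderiv_le i g)
    (totalDegree_pderiv_le j g)) (totalDegree_pderiv_le k g)
  omega

theorem totalDegree_rem₁_le : (rem₁ g).totalDegree ≤ 4 * g.totalDegree := by
  have e : rem₁ g = 2 * (pderiv 2 g * pderiv 2 g * pderiv 2 g * pderiv 0 (pderiv 1 g))
      - (pderiv 2 g * pderiv 2 g * pderiv 1 g * pderiv 1 (pderiv 1 g)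
      + 2 * (pderiv 2 g * pderiv 2 g * pderiv 1 g * pderiv 0 (pderiv 2 g)))
      + 2 * ((pderiv 2 g * pderiv 1 g * pderiv 1 g - pderiv 2 g * pderiv 2 g * pderiv 0 g) *
        pderiv 1 (pderiv 2 g))
      + (2 * (pderiv 2 g * pderiv 1 g * pderiv 0 g) - pderiv 1 g * pderiv 1 g * pderiv 1 g) *
        pderiv 2 (pderiv 2 g) := by
    rw [rem₁]; ring
  rw [e]
  refine totalDegree_add_le (totalDegree_add_le (totalDegree_sub_le
    (totalDegree_two_mul_le (totalDegree_mul_pderiv_pderiv_le _ _ (totalDegree_cubic_le _ _ _)))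
    (totalDegree_add_le (totalDegree_mul_pderiv_pderiv_le _ _ (totalDegree_cubic_le _ _ _))
    (totalDegree_two_mul_le (totalDegree_mul_pderiv_pderiv_le _ _ (totalDegree_cubic_le _ _ _)))))
    (totalDegree_two_mul_le (totalDegree_mul_pderiv_pderiv_le _ _ ?_)))
    (totalDegree_mul_pderiv_pderiv_le _ _ ?_)
  · exact totalDegree_sub_le (totalDegree_cubic_le _ _ _) (totalDegree_cubic_le _ _ _)
  · exact totalDegree_sub_le (totalDegree_two_mul_le (totalDegree_cubic_le _ _ _))
      (totalDegree_cubic_le _ _ _)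

theorem totalDegree_rem₀_le : (rem₀ g).totalDegree ≤ 4 * g.totalDegree := by
  have e : rem₀ g = pderiv 2 g * pderiv 2 g * pderiv 2 g * pderiv 0 (pderiv 0 g)
      - (pderiv 2 g * pderiv 2 g * pderiv 0 g * pderiv 1 (pderiv 1 g)
      + 2 * (pderiv 2 g * pderiv 2 g * pderiv 0 g * pderiv 0 (pderiv 2 g)))
      + 2 * (pderiv 2 g * pderiv 1 g * pderiv 0 g * pderiv 1 (pderiv 2 g))
      - (pderiv 0 g * pderiv 1 g * pderiv 1 g - pderiv 0 g * pderiv 2 g * pderiv 0 g) *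
        pderiv 2 (pderiv 2 g) := by
    rw [rem₀]; ring
  rw [e]
  refine totalDegree_sub_le (totalDegree_add_le (totalDegree_sub_le
    (totalDegree_mul_pderiv_pderiv_le _ _ (totalDegree_cubic_le _ _ _))
    (totalDegree_add_le (totalDegree_mul_pderiv_pderiv_le _ _ (totalDegree_cubic_le _ _ _))
    (totalDegree_two_mul_le (totalDegree_mul_pderiv_pderiv_le _ _ (totalDegree_cubic_le _ _ _)))))
    (totalDegree_two_mul_le (totalDegree_mul_pderiv_pderiv_le _ _ (totalDegree_cubic_le _ _ _))))
    (totalDegree_mul_pderiv_pderiv_le _ _ ?_)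
  exact totalDegree_sub_le (totalDegree_cubic_le _ _ _) (totalDegree_cubic_le _ _ _)

theorem totalDegree_disc_le : (disc g).totalDegree ≤ 2 * g.totalDegree := by
  have e : disc g = pderiv 1 g * pderiv 1 g - 2 * (2 * (pderiv 2 g * pderiv 0 g)) := by
    rw [disc]; ring
  have h (i j : Fin 3) : (pderiv i g * pderiv j g).totalDegree ≤ 2 * g.totalDegree := by
    have := totalDegree_mul_le (totalDegree_pderiv_le i g) (totalDegree_pderiv_le j g)
    omega
  rw [e]
  exact totalDegree_sub_le (h _ _) (totalDegree_two_mul_le (totalDegree_two_mul_le (h _ _)))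

end degrees

end

section

open MvPolynomial

variable {K : Type*} [Field K]

/-- The equation of a light sphere: a combination of `X₁² - X₀ X₂` and affine functions. -/
noncomputable def sph (c : Fin 5 → K) : MvPolynomial (Fin 3) K :=
  C (c 0) * (X 1 ^ 2 - X 0 * X 2) + C (c 1) * X 0 + C (c 2) * X 1 + C (c 3) * X 2 + C (c 4)

theorem restr_sph (c : Fin 5 → K) (r : LightRay K) :
    r.restr (sph c) = Polynomial.C (c 0 * r.u ^ 2 + c 2 * r.u + c 3 * r.v + c 4) +
      Polynomial.X * Polynomial.C (c 0 * (2 * r.u * r.s - r.v) + c 1 + c 2 * r.s + c 3 * r.s ^ 2) := by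
  simp only [sph, map_add, map_sub, map_mul, map_pow, restr_C, restr_X_zero, restr_X_one,
    restr_X_two, map_ofNat]
  ring

theorem lies_sph_iff {c : Fin 5 → K} {r : LightRay K} :
    Lies (sph c) r ↔ c 0 * r.u ^ 2 + c 2 * r.u + c 3 * r.v + c 4 = 0 ∧
      c 0 * (2 * r.u * r.s - r.v) + c 1 + c 2 * r.s + c 3 * r.s ^ 2 = 0 := by
  rw [Lies, restr_sph]
  constructor
  · intro h
    have h0 := congrArg (Polynomial.coeff · 0) h
    have h1 := congrArg (Polynomial.coeff · 1) h
    simp only [Polynomial.coeff_add, Polynomial.coeff_C_zero, Polynomial.mul_coeff_zero,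
      Polynomial.coeff_X_zero, zero_mul, add_zero, Polynomial.coeff_zero, Polynomial.coeff_C_succ,
      Polynomial.coeff_X_mul, zero_add] at h0 h1
    exact ⟨h0, h1⟩
  · rintro ⟨h0, h1⟩
    rw [h0, h1]
    simp

theorem lies_sph_of_eval {c : Fin 5 → K} {r : LightRay K} {t₀ t₁ : K} (ht : t₀ ≠ t₁)
    (h₀ : eval (r.pt t₀) (sph c) = 0) (h₁ : eval (r.pt t₁) (sph c) = 0) : Lies (sph c) r := by
  rw [← eval_restr, restr_sph] at h₀ h₁
  simp only [Polynomial.eval_add, Polynomial.eval_C, Polynomial.eval_mul, Polynomial.eval_X]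
    at h₀ h₁
  rw [lies_sph_iff]
  have := (mul_eq_zero.1 (show (t₀ - t₁) * (c 0 * (2 * r.u * r.s - r.v) + c 1 + c 2 * r.s +
    c 3 * r.s ^ 2) = 0 by linear_combination h₀ - h₁)).resolve_left (sub_ne_zero.2 ht)
  exact ⟨by rw [this] at h₀; linear_combination h₀, this⟩

theorem exists_sph_eval_eq_zero (z : Fin 4 → Fin 3 → K) :
    ∃ c : Fin 5 → K, c ≠ 0 ∧ ∀ i, eval (z i) (sph c) = 0 := by
  let φ : (Fin 5 → K) →ₗ[K] (Fin 4 → K) := LinearMap.pi fun i =>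
    { toFun := fun c => eval (z i) (sph c)
      map_add' := fun c c' => by simp [sph]; ring
      map_smul' := fun a c => by simp [sph]; ring }
  obtain ⟨c, hc, hc0⟩ := (Submodule.ne_bot_iff _).1
    (LinearMap.ker_ne_bot_of_finrank_lt (f := φ) (by simp))
  exact ⟨c, hc0, fun i => congrFun (LinearMap.mem_ker.1 hc) i⟩

/-- The light ray with slope `τ` through a point. -/
def thru (z : Fin 3 → K) (τ : K) : LightRay K := ⟨τ, z 1 - z 0 * τ, z 2 - z 0 * τ ^ 2⟩

theorem pt_thru {z : Fin 3 → K} {τ t : K} (ht : z 0 = t) : (thru z τ).pt t = z := by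
  subst ht
  ext i
  fin_cases i <;> simp [thru]

theorem eval_dirD (s : K) (g : MvPolynomial (Fin 3) K) (z : Fin 3 → K) :
    eval z (dirD s g) = eval z (pderiv 0 g) + s * eval z (pderiv 1 g)
      + s ^ 2 * eval z (pderiv 2 g) := by
  simp [dirD]

theorem eval_disc (g : MvPolynomial (Fin 3) K) (z : Fin 3 → K) :
    eval z (disc g) = eval z (pderiv 1 g) ^ 2
      - 4 * eval z (pderiv 2 g) * eval z (pderiv 0 g) := by
  simp [disc]

variable {g : MvPolynomial (Fin 3) K}

/-- Through a general point of a light ray on a doubly ruled surface there is a second one. -/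
theorem exists_second_ray {p : ℕ} [Fact p.Prime] [CharP K p] (hp : g.totalDegree < p)
    (h₁ : g ∣ rem₁ g) (h₀ : g ∣ rem₀ g) {r : LightRay K} (hr : Lies g r) {t : K}
    (ht : eval (r.pt t) (pderiv 2 g * disc g) ≠ 0) :
    ∃ δ, δ ≠ 0 ∧ eval (r.pt t) (pderiv 2 g) * δ + eval (r.pt t) (pderiv 1 g + C (2 * r.s) *
      pderiv 2 g) = 0 ∧ Lies g (thru (r.pt t) (r.s + δ)) := by
  rw [map_mul] at ht
  have hA := left_ne_zero_of_mul ht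
  have hd := right_ne_zero_of_mul ht
  have hQ := hr.eval_dirD t
  rw [eval_dirD] at hQ
  rw [eval_disc] at hd
  simp only [map_add, map_mul, eval_C]
  set A := eval (r.pt t) (pderiv 2 g)
  set B := eval (r.pt t) (pderiv 1 g)
  set D := eval (r.pt t) (pderiv 0 g)
  obtain ⟨δ, hδ⟩ : ∃ δ, A * δ + (B + 2 * r.s * A) = 0 :=
    ⟨-(B + 2 * r.s * A) / A, by field_simp; ring⟩
  refine ⟨δ, ?_, hδ, ?_⟩
  · rintro rfl
    apply hd
    linear_combination (-4 * A) * hQ + (B + 2 * r.s * A) * hδ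
  · have hz : (thru (r.pt t) (r.s + δ)).pt t = r.pt t := pt_thru rfl
    refine lies_of_eval_dirD (p := p) hp h₁ h₀ (t := t) ?_ ?_ ?_
    · rw [hz]; exact hr.eval t
    · rw [hz, eval_dirD]
      change D + (r.s + δ) * B + (r.s + δ) ^ 2 * A = 0
      linear_combination hQ + δ * hδ
    · rw [hz]; exact hA

/-- An irreducible surface containing an infinite family of light rays of another surface is a
component of the latter. -/
theorem dvd_of_infinite (hg : Irreducible g) {h : MvPolynomial (Fin 3) K}
    {S : Set (LightRay K)} (hS : S.Infinite) (hSg : ∀ r ∈ S, Lies g r) (hSh : ∀ r ∈ S, Lies h r) :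
    g ∣ h := by
  by_contra hn
  obtain ⟨M, hM, hc⟩ := hS.exists_subset_card_eq (g.totalDegree * h.totalDegree + 1)
  have := card_le_of_not_dvd hg hn M (fun r hr => hSg r (hM hr)) (fun r hr => hSh r (hM hr))
  omega

/-- The homogenization of degree `n` of a polynomial, evaluated at `P` and `Q`. -/
noncomputable def homog (n : ℕ) (α : Polynomial K) (P Q : MvPolynomial (Fin 3) K) :
    MvPolynomial (Fin 3) K :=
  ∑ i ∈ Finset.range (n + 1), C (α.coeff i) * P ^ i * Q ^ (n - i)

theorem eval_homog {n : ℕ} {α : Polynomial K} (hα : α.natDegree ≤ n)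
    {P Q : MvPolynomial (Fin 3) K} {z : Fin 3 → K} {x : K} (hx : eval z P = x * eval z Q) :
    eval z (homog n α P Q) = eval z Q ^ n * α.eval x := by
  rw [homog, map_sum, Polynomial.eval_eq_sum_range' (Nat.lt_succ_of_le hα), Finset.mul_sum]
  refine Finset.sum_congr rfl fun i hi => ?_
  have hi : i ≤ n := Nat.lt_succ_iff.1 (Finset.mem_range.1 hi)
  simp only [map_mul, map_pow, eval_C, hx]
  rw [← Nat.sub_add_cancel hi, pow_add]
  simp only [Nat.add_sub_cancel]
  ring

theorem finite_zeros {r : LightRay K} {f : MvPolynomial (Fin 3) K} (h : ¬ Lies f r) :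
    {t | eval (r.pt t) f = 0}.Finite := by
  simp only [← eval_restr]
  exact Polynomial.finite_setOfPred_isRoot h

/-- A doubly ruled irreducible surface is contained in a light sphere. -/
theorem exists_dvd_sph [Infinite K] {p : ℕ} [Fact p.Prime] [CharP K p] (hg : Irreducible g)
    (hp : g.totalDegree < p) (h₁ : g ∣ rem₁ g) (h₀ : g ∣ rem₀ g) {r : LightRay K} (hr : Lies g r)
    (hrd : ¬ Lies (pderiv 2 g * disc g) r) : ∃ c : Fin 5 → K, c ≠ 0 ∧ g ∣ sph c := by
  obtain ⟨t₀, ht₀⟩ := (finite_zeros hrd).infinite_compl.nonempty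
  obtain ⟨t₁, ht₁, hne⟩ := ((finite_zeros hrd).infinite_compl.sdiff
    (Set.finite_singleton t₀)).nonempty
  have hne : t₁ ≠ t₀ := hne
  have ht₀ : eval (r.pt t₀) (pderiv 2 g * disc g) ≠ 0 := ht₀
  obtain ⟨δ₀, hδ₀, -, hr'⟩ := exists_second_ray hp h₁ h₀ hr ht₀
  obtain ⟨δ₁, hδ₁, -, hr₁⟩ := exists_second_ray hp h₁ h₀ hr ht₁
  set r' := thru (r.pt t₀) (r.s + δ₀) with hr'_def
  set r₁ := thru (r.pt t₁) (r.s + δ₁) with hr₁_def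
  have hr'pt : r'.pt t₀ = r.pt t₀ := pt_thru rfl
  have hr₁pt : r₁.pt t₁ = r.pt t₁ := pt_thru rfl
  obtain ⟨c, hc0, hc⟩ := exists_sph_eval_eq_zero
    ![r.pt t₀, r.pt t₁, r'.pt (t₀ + 1), r₁.pt (t₁ + 1)]
  have hcr' : Lies (sph c) r' := by
    refine lies_sph_of_eval (t₀ := t₀) (t₁ := t₀ + 1) (by simp) ?_ ?_
    · rw [hr'pt]; exact hc 0
    · exact hc 2
  have hcr₁ : Lies (sph c) r₁ := by
    refine lies_sph_of_eval (t₀ := t₁) (t₁ := t₁ + 1) (by simp) ?_ ?_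
    · rw [hr₁pt]; exact hc 1
    · exact hc 3
  refine ⟨c, hc0, ?_⟩
  have hrd' : ¬ Lies (pderiv 2 g * disc g) r' := fun hl => ht₀ (by rw [← hr'pt]; exact hl.eval t₀)
  have hbad := finite_zeros hrd'
  have hgood (x : K) : ∃ δ, eval (r'.pt x) (pderiv 2 g * disc g) ≠ 0 → δ ≠ 0 ∧
      eval (r'.pt x) (pderiv 2 g) * δ + eval (r'.pt x) (pderiv 1 g + C (2 * r'.s) *
      pderiv 2 g) = 0 ∧ Lies g (thru (r'.pt x) (r'.s + δ)) := by
    by_cases hx : eval (r'.pt x) (pderiv 2 g * disc g) ≠ 0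
    · obtain ⟨δ, h⟩ := exists_second_ray hp h₁ h₀ hr' hx
      exact ⟨δ, fun _ => h⟩
    · exact ⟨0, fun h => absurd h hx⟩
  choose δ hδ using hgood
  set ρ : K → LightRay K := fun x => thru (r'.pt x) (r'.s + δ x) with hρ
  have hρinj : Set.InjOn ρ {t | eval (r'.pt t) (pderiv 2 g * disc g) = 0}ᶜ := by
    intro x hx y hy hxy
    have e1 : r'.s + δ x = r'.s + δ y := congrArg LightRay.s hxy
    have e2 : r'.u + x * r'.s - x * (r'.s + δ x) = r'.u + y * r'.s - y * (r'.s + δ y) :=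
      congrArg LightRay.u hxy
    have e1 : δ x = δ y := add_left_cancel e1
    rw [← e1] at e2
    exact mul_right_cancel₀ (hδ x hx).1 (by linear_combination -e2)
  set m : MvPolynomial (Fin 3) K := X 1 - C r'.u - C r'.s * X 0 with hm
  set k : MvPolynomial (Fin 3) K :=
    X 2 - C r'.v - C (2 * r'.s) * (X 1 - C r'.u) + C (r'.s ^ 2) * X 0 with hk
  set P : MvPolynomial (Fin 3) K := X 0 * k - m ^ 2 with hP
  have em (z : Fin 3 → K) : eval z m = z 1 - r'.u - r'.s * z 0 := by simp [hm]
  have ek (z : Fin 3 → K) :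
      eval z k = z 2 - r'.v - 2 * r'.s * (z 1 - r'.u) + r'.s ^ 2 * z 0 := by simp [hk]
  have eP (z : Fin 3 → K) : eval z P = z 0 * eval z k - eval z m ^ 2 := by simp [hP]
  set α := r'.restr (pderiv 2 g) with hα
  set β := r'.restr (pderiv 1 g + C (2 * r'.s) * pderiv 2 g) with hβ
  set n := max α.natDegree β.natDegree with hn
  set E := k * homog n α P k + m * homog n β P k with hE
  have eE {z : Fin 3 → K} {x : K} (hx : eval z P = x * eval z k) :
      eval z E = eval z k ^ n * (eval z k * α.eval x + eval z m * β.eval x) := by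
    rw [hE, map_add, map_mul, map_mul, eval_homog (le_max_left _ _) hx,
      eval_homog (le_max_right _ _) hx]
    ring
  have hgE : g ∣ E := by
    refine dvd_of_infinite hg (hbad.infinite_compl.image hρinj) ?_ ?_
    · rintro _ ⟨x, hx, rfl⟩
      exact (hδ x hx).2.2
    · rintro _ ⟨x, hx, rfl⟩
      rw [lies_iff_eval]
      intro t
      have hm' : eval ((ρ x).pt t) m = (t - x) * δ x := by
        rw [em]; simp [hρ, thru]; ring
      have hk' : eval ((ρ x).pt t) k = (t - x) * δ x ^ 2 := by
        rw [ek]; simp [hρ, thru]; ring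
      rw [eE (x := x) (by rw [eP, hm', hk', pt_zero]; ring), hm', hk', hα, hβ, eval_restr,
        eval_restr]
      linear_combination (((t - x) * δ x ^ 2) ^ n * ((t - x) * δ x)) * (hδ x hx).2.1
  have hmr₁ (ν : K) : eval (r₁.pt (t₁ + ν)) m = (t₁ - t₀) * (-δ₀) + ν * (δ₁ - δ₀) := by
    rw [em]; simp [hr₁_def, hr'_def, thru]; ring
  have hkr₁ (ν : K) : eval (r₁.pt (t₁ + ν)) k = (t₁ - t₀) * δ₀ ^ 2 + ν * (δ₁ - δ₀) ^ 2 := by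
    rw [ek]; simp [hr₁_def, hr'_def, thru]; ring
  have hL : t₁ - t₀ ≠ 0 := sub_ne_zero.2 hne
  have hk₁ : ¬ Lies k r₁ := fun hl => by
    have := hl.eval (t₁ + 0)
    rw [hkr₁] at this
    simp [hL, hδ₀] at this
  have hPx (x : K) : ¬ Lies (P - C x * k) r₁ := fun hl => by
    have e0 := hl.eval (t₁ + 0)
    have e1 := hl.eval (t₁ + 1)
    rw [map_sub, map_mul, eval_C, eP, hkr₁, hmr₁, pt_zero] at e0 e1
    have hx : (t₁ - t₀) * δ₀ ^ 2 * (t₀ - x) = 0 := by linear_combination e0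
    have hx := (mul_eq_zero.1 hx).resolve_left (mul_ne_zero hL (pow_ne_zero 2 hδ₀))
    have : (t₁ - t₀) * δ₁ ^ 2 = 0 := by
      rw [sub_eq_zero] at hx
      rw [← hx] at e1
      linear_combination e1
    exact mul_ne_zero hL (pow_ne_zero 2 hδ₁) this
  have hinf : ({x | eval (r'.pt x) (pderiv 2 g * disc g) = 0}ᶜ ∩
      {x | Lies (sph c) (ρ x)}).Infinite := by
    intro hfin
    have hall : (Set.univ : Set K) ⊆ {t | eval (r₁.pt t) k = 0} ∪
        ⋃ x ∈ {x | eval (r'.pt x) (pderiv 2 g * disc g) = 0} ∪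
          ({x | eval (r'.pt x) (pderiv 2 g * disc g) = 0}ᶜ ∩ {x | Lies (sph c) (ρ x)}),
          {t | eval (r₁.pt t) (P - C x * k) = 0} := by
      intro t _
      by_cases hkt : eval (r₁.pt t) k = 0
      · exact Or.inl hkt
      right
      set x := eval (r₁.pt t) P / eval (r₁.pt t) k with hx
      have hxP : eval (r₁.pt t) P = x * eval (r₁.pt t) k := (div_mul_cancel₀ _ hkt).symm
      have ht : t ∈ {t | eval (r₁.pt t) (P - C x * k) = 0} := by
        simp [hxP]
      refine Set.mem_biUnion ?_ ht
      by_cases hxb : eval (r'.pt x) (pderiv 2 g * disc g) = 0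
      · exact Or.inl hxb
      refine Or.inr ⟨hxb, ?_⟩
      obtain ⟨hδ0, hδx, -⟩ := hδ x hxb
      have hA : eval (r'.pt x) (pderiv 2 g) ≠ 0 := by
        rw [map_mul] at hxb
        exact left_ne_zero_of_mul hxb
      have hEz := (hr₁.of_dvd hgE).eval t
      rw [eE hxP, mul_eq_zero, hα, hβ, eval_restr, eval_restr] at hEz
      have hEz := hEz.resolve_left (pow_ne_zero _ hkt)
      have hkm : eval (r₁.pt t) k = eval (r₁.pt t) m * δ x := by
        apply mul_left_cancel₀ hA
        linear_combination hEz - eval (r₁.pt t) m * hδx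
      have hm0 : eval (r₁.pt t) m ≠ 0 := fun h0 => hkt (by rw [hkm, h0, zero_mul])
      have hmt : eval (r₁.pt t) m = (t - x) * δ x := by
        rw [eP, pt_zero, hkm] at hxP
        apply mul_left_cancel₀ hm0
        linear_combination -hxP
      have hpt : r₁.pt t = (ρ x).pt t := by
        rw [hmt] at hkm
        have e1 := em (r₁.pt t)
        have e2 := ek (r₁.pt t)
        rw [hkm] at e2
        rw [hmt] at e1
        rw [pt_zero] at e1 e2
        ext i
        fin_cases i
        · rfl
        · simp only [Fin.mk_one, Fin.isValue]
          rw [show (ρ x).pt t 1 = r'.u + x * r'.s - x * (r'.s + δ x) + t * (r'.s + δ x) from rfl]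
          linear_combination -e1
        · simp only [Fin.reduceFinMk, Fin.isValue]
          rw [show (ρ x).pt t 2 = r'.v + x * r'.s ^ 2 - x * (r'.s + δ x) ^ 2 +
            t * (r'.s + δ x) ^ 2 from rfl]
          linear_combination -e2 - 2 * r'.s * e1
      have htx : t ≠ x := by
        rintro h
        rw [hmt, ← h] at hm0
        simp at hm0
      refine lies_sph_of_eval htx ?_ (?_ : eval ((ρ x).pt x) (sph c) = 0)
      · rw [← hpt]; exact hcr₁.eval t
      · rw [show (ρ x).pt x = r'.pt x from pt_thru rfl]; exact hcr'.eval x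
    refine Set.infinite_univ ((((finite_zeros hk₁).union ?_)).subset hall)
    exact (hbad.union hfin).biUnion fun x _ => finite_zeros (hPx x)
  refine dvd_of_infinite hg (hinf.image (hρinj.mono Set.inter_subset_left)) ?_ ?_
  · rintro _ ⟨x, hx, rfl⟩
    exact (hδ x hx.1).2.2
  · rintro _ ⟨x, hx, rfl⟩
    exact hx.2
end

section

open MvPolynomial

open scoped Classical in
/-- The number of meeting pairs of two finite families of light rays. -/
noncomputable def meets {K : Type*} [Field K] (B₁ B₂ : Finset (LightRay K)) : ℕ :=
  ((B₁ ×ˢ B₂).filter fun x => Meet x.1 x.2).card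

variable {K : Type*} [Field K]

/-- No two distinct members of the family meet. -/
def Skew (B : Finset (LightRay K)) : Prop := ∀ r₁ ∈ B, ∀ r₂ ∈ B, Meet r₁ r₂ → r₁ = r₂

theorem Skew.mono {B B' : Finset (LightRay K)} (h : Skew B) (hB : B' ⊆ B) : Skew B' :=
  fun r₁ h₁ r₂ h₂ => h r₁ (hB h₁) r₂ (hB h₂)

open scoped Classical in
theorem meets_eq_sum (B₁ B₂ : Finset (LightRay K)) :
    meets B₁ B₂ = ∑ r ∈ B₁, (B₂.filter fun r' => Meet r r').card := by
  rw [meets, Finset.card_filter, Finset.sum_product]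
  simp only [Finset.card_filter]

theorem meets_comm (B₁ B₂ : Finset (LightRay K)) : meets B₁ B₂ = meets B₂ B₁ := by
  classical
  rw [meets_eq_sum, meets, Finset.card_filter, Finset.sum_product_right]
  refine Finset.sum_congr rfl fun r _ => ?_
  rw [Finset.card_filter]
  refine Finset.sum_congr rfl fun r' _ => ?_
  simp only [show Meet r r' ↔ Meet r' r from ⟨Meet.symm, Meet.symm⟩]

theorem meets_le_card_mul_card (B₁ B₂ : Finset (LightRay K)) :
    meets B₁ B₂ ≤ B₁.card * B₂.card := by
  classical
  rw [← Finset.card_product]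
  exact Finset.card_filter_le _ _

open scoped Classical in
theorem meets_split_left (P : LightRay K → Prop) (B₁ B₂ : Finset (LightRay K)) :
    meets B₁ B₂ = meets (B₁.filter P) B₂ + meets (B₁.filter fun r => ¬ P r) B₂ := by
  simp only [meets_eq_sum]
  exact (Finset.sum_filter_add_sum_filter_not _ _ _).symm

open scoped Classical in
theorem meets_split (P : LightRay K → Prop) (B₁ B₂ : Finset (LightRay K)) :
    meets B₁ B₂ = meets (B₁.filter P) (B₂.filter P) +
      meets (B₁.filter P) (B₂.filter fun r => ¬ P r) +
      (meets (B₁.filter fun r => ¬ P r) (B₂.filter P) +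
      meets (B₁.filter fun r => ¬ P r) (B₂.filter fun r => ¬ P r)) := by
  rw [meets_split_left P]
  congr 1 <;> rw [meets_comm, meets_split_left P, meets_comm, add_right_inj, meets_comm]

theorem meets_le_of_not_lies {h : MvPolynomial (Fin 3) K} {B₁ B₂ : Finset (LightRay K)}
    (hB : Skew B₂) (hl : ∀ r ∈ B₁, ¬ Lies h r)
    (hz : ∀ r ∈ B₁, ∀ r' ∈ B₂, ∀ t, r.pt t = r'.pt t → eval (r.pt t) h = 0) :
    meets B₁ B₂ ≤ h.totalDegree * B₁.card := by
  classical
  rw [meets_eq_sum, mul_comm]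
  refine Finset.sum_le_card_nsmul _ _ _ fun r hr => ?_
  refine card_meet_le (hl r hr) _ (hB.mono (Finset.filter_subset _ _)) fun r' hr' => ?_
  obtain ⟨hr', t, ht⟩ := Finset.mem_filter.1 hr'
  exact ⟨t, ht, hz r hr r' hr' t ht⟩

theorem meets_le_of_not_lies' {h : MvPolynomial (Fin 3) K} {B₁ B₂ : Finset (LightRay K)}
    (hB : Skew B₁) (hl : ∀ r ∈ B₂, ¬ Lies h r)
    (hz : ∀ r ∈ B₁, ∀ r' ∈ B₂, ∀ t, r.pt t = r'.pt t → eval (r.pt t) h = 0) :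
    meets B₁ B₂ ≤ h.totalDegree * B₂.card := by
  rw [meets_comm]
  exact meets_le_of_not_lies hB hl fun r hr r' hr' t ht => by
    rw [ht]; exact hz r' hr' r hr t ht.symm

theorem totalDegree_pos_of_irreducible {g : MvPolynomial (Fin 3) K} (hg : Irreducible g) :
    0 < g.totalDegree := by
  rw [Nat.pos_iff_ne_zero]
  intro h
  rw [totalDegree_eq_zero_iff_eq_C] at h
  refine hg.not_isUnit ?_
  rw [h]
  refine (IsUnit.mk0 _ fun h0 => hg.ne_zero ?_).map C
  rw [h, h0, C_0]

theorem not_dvd_pderiv {g : MvPolynomial (Fin 3) K} {i : Fin 3} (h : pderiv i g ≠ 0) :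
    ¬ g ∣ pderiv i g := by
  intro hd
  have := totalDegree_le_of_dvd_of_isDomain hd h
  have := totalDegree_pderiv_succ_le h
  omega

/-- Two families of light rays, each skew, with no common slope, such that no light sphere
contains more than `k` rays of the first family. -/
structure Admissible (k : ℕ) (B₁ B₂ : Finset (LightRay K)) : Prop where
  skew₁ : Skew B₁
  skew₂ : Skew B₂
  slope : ∀ r₁ ∈ B₁, ∀ r₂ ∈ B₂, r₁.s ≠ r₂.s
  sphere : ∀ c : Fin 5 → K, c ≠ 0 → ∀ E ⊆ B₁, (∀ r ∈ E, Lies (sph c) r) → E.card ≤ k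

theorem Admissible.mono {k : ℕ} {B₁ B₂ E₁ E₂ : Finset (LightRay K)} (h : Admissible k B₁ B₂)
    (h₁ : E₁ ⊆ B₁) (h₂ : E₂ ⊆ B₂) : Admissible k E₁ E₂ where
  skew₁ := h.skew₁.mono h₁
  skew₂ := h.skew₂.mono h₂
  slope r₁ hr₁ r₂ hr₂ := h.slope r₁ (h₁ hr₁) r₂ (h₂ hr₂)
  sphere c hc E hE := h.sphere c hc E (hE.trans h₁)

theorem exists_reduction_of_not_dvd {k : ℕ} {g h : MvPolynomial (Fin 3) K} (hg : Irreducible g)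
    {B₁ B₂ : Finset (LightRay K)} (hB : Admissible k B₁ B₂) (h₁ : ∀ r ∈ B₁, Lies g r)
    (h₂ : ∀ r ∈ B₂, Lies g r) (hgh : ¬ g ∣ h) (hd : h.totalDegree ≤ 4 * g.totalDegree)
    (hz : ∀ r ∈ B₁, ∀ r' ∈ B₂, ∀ t, r.pt t = r'.pt t → eval (r.pt t) h = 0) :
    ∃ E₁ ⊆ B₁, ∃ E₂ ⊆ B₂, E₁.card ≤ 4 * g.totalDegree ^ 2 ∧ E₂.card ≤ 4 * g.totalDegree ^ 2 ∧
      meets B₁ B₂ + k * E₂.card ≤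
        4 * g.totalDegree * (B₁.card + B₂.card) + k * B₂.card + meets E₁ E₂ := by
  classical
  have hcard (B : Finset (LightRay K)) (hl : ∀ r ∈ B, Lies g r) :
      (B.filter (Lies h)).card ≤ 4 * g.totalDegree ^ 2 := by
    refine (card_le_of_not_dvd hg hgh _ (fun r hr => hl r (Finset.mem_filter.1 hr).1)
      fun r hr => (Finset.mem_filter.1 hr).2).trans ?_
    nlinarith [Nat.mul_le_mul_left g.totalDegree hd]
  refine ⟨B₁.filter (Lies h), Finset.filter_subset _ _, B₂.filter (Lies h),
    Finset.filter_subset _ _, hcard _ h₁, hcard _ h₂, ?_⟩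
  have e1 := Nat.mul_le_mul_left k (Finset.card_filter_le B₂ (Lies h))
  have e2 := meets_split_left (Lies h) B₁ B₂
  have e3 := meets_split_left (Lies h) B₂ (B₁.filter (Lies h))
  rw [meets_comm, meets_comm _ (B₁.filter (Lies h)), meets_comm _ (B₁.filter (Lies h))] at e3
  have e4 : meets (B₁.filter fun r => ¬ Lies h r) B₂ ≤ h.totalDegree * _ :=
    meets_le_of_not_lies hB.skew₂ (fun r hr => (Finset.mem_filter.1 hr).2)
      fun r hr => hz r (Finset.mem_filter.1 hr).1
  have e5 : meets (B₁.filter (Lies h)) (B₂.filter fun r => ¬ Lies h r) ≤ h.totalDegree * _ :=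
    meets_le_of_not_lies' (hB.skew₁.mono (Finset.filter_subset _ _))
      (fun r hr => (Finset.mem_filter.1 hr).2)
      fun r hr r' hr' => hz r (Finset.mem_filter.1 hr).1 r' (Finset.mem_filter.1 hr').1
  have e6 := Nat.mul_le_mul hd (Finset.card_filter_le B₁ fun r => ¬ Lies h r)
  have e7 := Nat.mul_le_mul hd (Finset.card_filter_le B₂ fun r => ¬ Lies h r)
  linarith

/-- The two slopes at a meeting point determine the direction form. -/
theorem eval_disc_eq {g : MvPolynomial (Fin 3) K} {r₁ r₂ : LightRay K} (h₁ : Lies g r₁)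
    (h₂ : Lies g r₂) (hs : r₁.s ≠ r₂.s) {t : K} (ht : r₁.pt t = r₂.pt t) :
    eval (r₁.pt t) (pderiv 1 g) = -eval (r₁.pt t) (pderiv 2 g) * (r₁.s + r₂.s) ∧
      eval (r₁.pt t) (pderiv 0 g) = eval (r₁.pt t) (pderiv 2 g) * (r₁.s * r₂.s) := by
  have e₁ := h₁.eval_dirD t
  have e₂ := h₂.eval_dirD t
  rw [← ht] at e₂
  rw [eval_dirD] at e₁ e₂
  have hB : eval (r₁.pt t) (pderiv 1 g) = -eval (r₁.pt t) (pderiv 2 g) * (r₁.s + r₂.s) := by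
    apply mul_left_cancel₀ (sub_ne_zero.2 hs)
    linear_combination e₁ - e₂
  exact ⟨hB, by rw [hB] at e₁; linear_combination e₁⟩

theorem exists_reduction_of_irreducible [Infinite K] {p : ℕ} [Fact p.Prime] [CharP K p] {k : ℕ}
    {g : MvPolynomial (Fin 3) K} (hg : Irreducible g) (hp : g.totalDegree < p)
    {B₁ B₂ : Finset (LightRay K)} (hB : Admissible k B₁ B₂) (h₁ : ∀ r ∈ B₁, Lies g r)
    (h₂ : ∀ r ∈ B₂, Lies g r) :
    ∃ E₁ ⊆ B₁, ∃ E₂ ⊆ B₂, E₁.card ≤ 4 * g.totalDegree ^ 2 ∧ E₂.card ≤ 4 * g.totalDegree ^ 2 ∧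
      meets B₁ B₂ + k * E₂.card ≤
        4 * g.totalDegree * (B₁.card + B₂.card) + k * B₂.card + meets E₁ E₂ := by
  have hdeg (i : Fin 3) : (pderiv i g).totalDegree ≤ 4 * g.totalDegree := by
    have := totalDegree_pderiv_le i g
    omega
  by_cases hA : pderiv 2 g = 0
  · obtain ⟨i, hi⟩ := exists_pderiv_ne_zero (p := p) (totalDegree_pos_of_irreducible hg) hp
    refine exists_reduction_of_not_dvd hg hB h₁ h₂ (not_dvd_pderiv hi) (hdeg i) ?_
    intro r hr r' hr' t ht
    obtain ⟨e1, e0⟩ := eval_disc_eq (h₁ r hr) (h₂ r' hr') (hB.slope r hr r' hr') ht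
    rw [hA, map_zero] at e1 e0
    fin_cases i
    · simpa using e0
    · simpa using e1
    · exact absurd hA hi
  by_cases hD : g ∣ disc g
  · refine exists_reduction_of_not_dvd hg hB h₁ h₂ (not_dvd_pderiv hA) (hdeg 2) ?_
    intro r hr r' hr' t ht
    obtain ⟨e1, e0⟩ := eval_disc_eq (h₁ r hr) (h₂ r' hr') (hB.slope r hr r' hr') ht
    have ed := ((h₁ r hr).of_dvd hD).eval t
    rw [eval_disc, e1, e0] at ed
    have : (eval (r.pt t) (pderiv 2 g) * (r.s - r'.s)) ^ 2 = 0 := by linear_combination ed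
    exact (mul_eq_zero.1 (pow_eq_zero_iff two_ne_zero |>.1 this)).resolve_right
      (sub_ne_zero.2 (hB.slope r hr r' hr'))
  by_cases hr₁ : g ∣ rem₁ g
  swap
  · exact exists_reduction_of_not_dvd hg hB h₁ h₂ hr₁ totalDegree_rem₁_le
      fun r hr r' hr' t ht =>
        (eval_rem_eq_zero (h₁ r hr) (h₂ r' hr') (hB.slope r hr r' hr') ht).1
  by_cases hr₀ : g ∣ rem₀ g
  swap
  · exact exists_reduction_of_not_dvd hg hB h₁ h₂ hr₀ totalDegree_rem₀_le
      fun r hr r' hr' t ht =>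
        (eval_rem_eq_zero (h₁ r hr) (h₂ r' hr') (hB.slope r hr r' hr') ht).2
  by_cases hr : ∃ r, Lies g r ∧ ¬ Lies (pderiv 2 g * disc g) r
  · obtain ⟨r, hrg, hrd⟩ := hr
    obtain ⟨c, hc, hgc⟩ := exists_dvd_sph hg hp hr₁ hr₀ hrg hrd
    have hk := hB.sphere c hc B₁ subset_rfl fun r hr => (h₁ r hr).of_dvd hgc
    refine ⟨∅, Finset.empty_subset _, ∅, Finset.empty_subset _, by simp, by simp, ?_⟩
    have := (meets_le_card_mul_card B₁ B₂).trans (Nat.mul_le_mul_right _ hk)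
    simp only [Finset.card_empty, mul_zero, add_zero]
    omega
  · push Not at hr
    have hn : ¬ g ∣ pderiv 2 g * disc g := fun h =>
      (hg.prime.dvd_or_dvd h).elim (not_dvd_pderiv hA) hD
    have hcard (B : Finset (LightRay K)) (hl : ∀ r ∈ B, Lies g r) :
        B.card ≤ 4 * g.totalDegree ^ 2 := by
      refine (card_le_of_not_dvd hg hn B hl fun r h => hr r (hl r h)).trans ?_
      have := totalDegree_mul_le (totalDegree_pderiv_le 2 g) (totalDegree_disc_le (g := g))
      nlinarith [Nat.mul_le_mul_left g.totalDegree this]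
    exact ⟨B₁, subset_rfl, B₂, subset_rfl, hcard _ h₁, hcard _ h₂, by omega⟩

theorem exists_reduction [Infinite K] {p : ℕ} [Fact p.Prime] [CharP K p] {k : ℕ}
    {f : MvPolynomial (Fin 3) K} (hf : f ≠ 0) (hp : f.totalDegree < p)
    {B₁ B₂ : Finset (LightRay K)} (hB : Admissible k B₁ B₂) (h₁ : ∀ r ∈ B₁, Lies f r)
    (h₂ : ∀ r ∈ B₂, Lies f r) :
    ∃ E₁ ⊆ B₁, ∃ E₂ ⊆ B₂, E₁.card ≤ 4 * f.totalDegree ^ 2 ∧ E₂.card ≤ 4 * f.totalDegree ^ 2 ∧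
      meets B₁ B₂ + k * E₂.card ≤
        5 * f.totalDegree * (B₁.card + B₂.card) + k * B₂.card + meets E₁ E₂ := by
  classical
  induction f using WfDvdMonoid.induction_on_irreducible generalizing B₁ B₂ with
  | zero => exact absurd rfl hf
  | unit u hu =>
    have hempty (B : Finset (LightRay K)) (hl : ∀ r ∈ B, Lies u r) : B = ∅ := by
      rw [Finset.eq_empty_iff_forall_notMem]
      intro r hr
      have := hu.map r.restr
      rw [hl r hr] at this
      exact not_isUnit_zero this
    obtain rfl := hempty _ h₁
    obtain rfl := hempty _ h₂
    exact ⟨∅, subset_rfl, ∅, subset_rfl, by simp, by simp, by simp⟩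
  | mul a g ha hg ih =>
    have hdeg := totalDegree_mul_of_isDomain hg.ne_zero ha
    rw [hdeg] at hp ⊢
    set B₁' := B₁.filter (Lies g) with hB₁'
    set B₂' := B₂.filter (Lies g) with hB₂'
    set B₁'' := B₁.filter (fun r => ¬ Lies g r) with hB₁''
    set B₂'' := B₂.filter (fun r => ¬ Lies g r) with hB₂''
    have s₁' : B₁' ⊆ B₁ := Finset.filter_subset _ _
    have s₂' : B₂' ⊆ B₂ := Finset.filter_subset _ _
    have s₁'' : B₁'' ⊆ B₁ := Finset.filter_subset _ _
    have s₂'' : B₂'' ⊆ B₂ := Finset.filter_subset _ _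
    have l₁' : ∀ r ∈ B₁', Lies g r := fun r hr => (Finset.mem_filter.1 hr).2
    have l₂' : ∀ r ∈ B₂', Lies g r := fun r hr => (Finset.mem_filter.1 hr).2
    have l₁'' : ∀ r ∈ B₁'', ¬ Lies g r := fun r hr => (Finset.mem_filter.1 hr).2
    have l₂'' : ∀ r ∈ B₂'', ¬ Lies g r := fun r hr => (Finset.mem_filter.1 hr).2
    obtain ⟨E₁', hE₁', E₂', hE₂', c₁', c₂', hm'⟩ := exists_reduction_of_irreducible hg (by omega)
      (hB.mono s₁' s₂') l₁' l₂'
    obtain ⟨E₁'', hE₁'', E₂'', hE₂'', c₁'', c₂'', hm''⟩ := ih ha (by omega) (hB.mono s₁'' s₂'')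
      (fun r hr => (lies_mul.1 (h₁ r (s₁'' hr))).resolve_left (l₁'' r hr))
      (fun r hr => (lies_mul.1 (h₂ r (s₂'' hr))).resolve_left (l₂'' r hr))
    have hfil {E E' B B' : Finset (LightRay K)} (hE : E ⊆ B) (hE' : E' ⊆ B')
        (hl : ∀ r ∈ B, Lies g r) (hl' : ∀ r ∈ B', ¬ Lies g r) :
        (E ∪ E').filter (Lies g) = E ∧ (E ∪ E').filter (fun r => ¬ Lies g r) = E' := by
      constructor
      · rw [Finset.filter_union, Finset.filter_true_of_mem fun r hr => hl r (hE hr),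
          Finset.filter_false_of_mem fun r hr => hl' r (hE' hr), Finset.union_empty]
      · rw [Finset.filter_union, Finset.filter_false_of_mem fun r hr h => h (hl r (hE hr)),
          Finset.filter_true_of_mem fun r hr => hl' r (hE' hr), Finset.empty_union]
    have hu₁ := Finset.card_union_le E₁' E₁''
    have hu₂ := Finset.card_union_le E₂' E₂''
    have hsq : 4 * g.totalDegree ^ 2 + 4 * a.totalDegree ^ 2 ≤
        4 * (g.totalDegree + a.totalDegree) ^ 2 := by nlinarith
    refine ⟨E₁' ∪ E₁'', Finset.union_subset (hE₁'.trans s₁') (hE₁''.trans s₁''),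
      E₂' ∪ E₂'', Finset.union_subset (hE₂'.trans s₂') (hE₂''.trans s₂''), by omega, by omega, ?_⟩
    have e1 := meets_split (Lies g) B₁ B₂
    have e2 := meets_split (Lies g) (E₁' ∪ E₁'') (E₂' ∪ E₂'')
    rw [(hfil hE₁' hE₁'' l₁' l₁'').1, (hfil hE₁' hE₁'' l₁' l₁'').2,
      (hfil hE₂' hE₂'' l₂' l₂'').1, (hfil hE₂' hE₂'' l₂' l₂'').2] at e2
    have e3 : meets B₁' B₂'' ≤ g.totalDegree * B₂''.card :=
      meets_le_of_not_lies' (hB.skew₁.mono s₁') l₂'' fun r hr _ _ t _ => (l₁' r hr).eval t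
    have e4 : meets B₁'' B₂' ≤ g.totalDegree * B₁''.card :=
      meets_le_of_not_lies (hB.skew₂.mono s₂') l₁'' fun r _ r' hr' t ht => by
        rw [ht]; exact (l₂' r' hr').eval t
    have e5 : B₁'.card + B₁''.card = B₁.card := Finset.card_filter_add_card_filter_not _
    have e6 : B₂'.card + B₂''.card = B₂.card := Finset.card_filter_add_card_filter_not _
    have e7 := Nat.mul_le_mul_left k hu₂
    rw [← e5, ← e6]
    nlinarith [Nat.zero_le (a.totalDegree * (B₁'.card + B₂'.card)),
      Nat.zero_le (g.totalDegree * (B₁'.card + B₂'.card)),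
      Nat.zero_le (g.totalDegree * (B₁''.card + B₂''.card))]

theorem meets_le_of_peeling [Infinite K] {p : ℕ} [Fact p.Prime] [CharP K p] {k m d N Φ : ℕ}
    (hd : d < p) (hm : 6 * m < (d + 2) * (d + 3)) (q : ℕ) {A₁ A₂ : Finset (LightRay K)}
    (hA : Admissible k A₁ A₂) (hq : A₁.card ≤ q * m) (h₁ : A₁.card ≤ N) (h₂ : A₂.card ≤ N)
    (hΦ : ∀ E₁ ⊆ A₁, ∀ E₂ ⊆ A₂, E₁.card ≤ 4 * d ^ 2 → E₂.card ≤ 4 * d ^ 2 →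
      meets E₁ E₂ ≤ Φ + k * E₂.card) :
    meets A₁ A₂ ≤ q * (2 * d * N + Φ) + 5 * d * (A₁.card + A₂.card) + k * A₂.card := by
  classical
  induction q generalizing A₁ A₂ with
  | zero =>
    have : A₁ = ∅ := by simpa using hq
    subst this
    simp [meets]
  | succ q ih =>
    obtain ⟨S, hS, hSc⟩ := Finset.exists_subset_card_eq (min_le_right m A₁.card)
    obtain ⟨f, hf, hfd, hfl⟩ := exists_lies S d (by
      have := min_le_left m A₁.card
      omega)
    set B₁ := A₁.filter (Lies f) with hB₁
    set B₂ := A₂.filter (Lies f) with hB₂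
    set C₁ := A₁.filter (fun r => ¬ Lies f r) with hC₁
    set C₂ := A₂.filter (fun r => ¬ Lies f r) with hC₂
    have sB₁ : B₁ ⊆ A₁ := Finset.filter_subset _ _
    have sB₂ : B₂ ⊆ A₂ := Finset.filter_subset _ _
    have sC₁ : C₁ ⊆ A₁ := Finset.filter_subset _ _
    have sC₂ : C₂ ⊆ A₂ := Finset.filter_subset _ _
    have lB₁ : ∀ r ∈ B₁, Lies f r := fun r hr => (Finset.mem_filter.1 hr).2
    have lB₂ : ∀ r ∈ B₂, Lies f r := fun r hr => (Finset.mem_filter.1 hr).2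
    have lC₁ : ∀ r ∈ C₁, ¬ Lies f r := fun r hr => (Finset.mem_filter.1 hr).2
    have lC₂ : ∀ r ∈ C₂, ¬ Lies f r := fun r hr => (Finset.mem_filter.1 hr).2
    obtain ⟨E₁, hE₁, E₂, hE₂, c₁, c₂, hE⟩ := exists_reduction hf (by omega) (hA.mono sB₁ sB₂)
      lB₁ lB₂
    have hsq : 4 * f.totalDegree ^ 2 ≤ 4 * d ^ 2 :=
      Nat.mul_le_mul_left _ (Nat.pow_le_pow_left hfd 2)
    have hΦE := hΦ E₁ (hE₁.trans sB₁) E₂ (hE₂.trans sB₂) (c₁.trans hsq) (c₂.trans hsq)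
    have e1 := meets_split (Lies f) A₁ A₂
    have e3 : meets B₁ C₂ ≤ f.totalDegree * C₂.card :=
      meets_le_of_not_lies' (hA.skew₁.mono sB₁) lC₂ fun r hr _ _ t _ => (lB₁ r hr).eval t
    have e4 : meets C₁ B₂ ≤ f.totalDegree * C₁.card :=
      meets_le_of_not_lies (hA.skew₂.mono sB₂) lC₁ fun r _ r' hr' t ht => by
        rw [ht]; exact (lB₂ r' hr').eval t
    have e3' := Nat.mul_le_mul hfd ((Finset.card_le_card sC₂).trans h₂)
    have e4' := Nat.mul_le_mul hfd ((Finset.card_le_card sC₁).trans h₁)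
    have e5 : B₁.card + C₁.card = A₁.card := Finset.card_filter_add_card_filter_not _
    have e6 : B₂.card + C₂.card = A₂.card := Finset.card_filter_add_card_filter_not _
    have hSB : S ⊆ B₁ := fun r hr => Finset.mem_filter.2 ⟨hS hr, hfl r hr⟩
    have hSB := Finset.card_le_card hSB
    have hCq : C₁.card ≤ q * m := by
      rw [add_mul, one_mul] at hq
      rcases min_choice m A₁.card with h | h <;> omega
    have e7 := ih (hA.mono sC₁ sC₂) hCq ((Finset.card_le_card sC₁).trans h₁)
      ((Finset.card_le_card sC₂).trans h₂)
      fun E₁ hE₁ E₂ hE₂ => hΦ E₁ (hE₁.trans sC₁) E₂ (hE₂.trans sC₂)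
    have e8 : 5 * f.totalDegree * (B₁.card + B₂.card) ≤ 5 * d * (B₁.card + B₂.card) := by gcongr
    rw [← e5, ← e6]
    nlinarith

/-- The incidence bound for light rays. -/
theorem meets_le [Infinite K] {p : ℕ} [Fact p.Prime] [CharP K p] {k : ℕ} (n : ℕ) (hn : n ≤ p)
    {A₁ A₂ : Finset (LightRay K)} (hA : Admissible k A₁ A₂) (h₁ : A₁.card ≤ n ^ 2)
    (h₂ : A₂.card ≤ n ^ 2) : meets A₁ A₂ ≤ 40000 * n ^ 3 + k * A₂.card := by
  induction n using Nat.strong_induction_on generalizing A₁ A₂ with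
  | _ n ih =>
    by_cases hsmall : n < 2304
    · have := (meets_le_card_mul_card A₁ A₂).trans (Nat.mul_le_mul h₁ h₂)
      have h3 : n ^ 2 * n ^ 2 ≤ 2304 * n ^ 3 := by
        calc n ^ 2 * n ^ 2 = n * n ^ 3 := by ring
          _ ≤ 2304 * n ^ 3 := Nat.mul_le_mul_right _ hsmall.le
      nlinarith [Nat.zero_le (n ^ 3), Nat.zero_le (k * A₂.card)]
    · push Not at hsmall
      set e := n / 2304 with he
      have he1 : 1 ≤ e := (Nat.one_le_div_iff (by norm_num)).2 hsmall
      have hen : 384 * (6 * e) ≤ n := by omega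
      have hne : n ≤ 4608 * e := by omega
      have hpeel := meets_le_of_peeling (p := p) (m := 6 * e ^ 2) (d := 6 * e) (N := n ^ 2)
        (Φ := 40000 * (2 * (6 * e)) ^ 3) (by omega) (by nlinarith) (24 * 384 ^ 2) hA (by nlinarith)
        h₁ h₂ (by
          intro E₁ hE₁ E₂ hE₂ c₁ c₂
          exact ih (2 * (6 * e)) (by omega) (by omega) (hA.mono hE₁ hE₂)
            (c₁.trans (by nlinarith)) (c₂.trans (by nlinarith)))
      set d := 6 * e with hd
      have hd2 : d * n ^ 2 * 384 ≤ n ^ 3 := by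
        calc d * n ^ 2 * 384 = 384 * d * n ^ 2 := by ring
          _ ≤ n * n ^ 2 := Nat.mul_le_mul_right _ hen
          _ = n ^ 3 := by ring
      have hd3 : (384 * d) ^ 3 ≤ n ^ 3 := Nat.pow_le_pow_left hen 3
      have h5 : 5 * d * (A₁.card + A₂.card) ≤ 5 * d * (n ^ 2 + n ^ 2) := by gcongr
      nlinarith
end

section

theorem meet_iff_of_ne {K : Type*} [Field K] {r₁ r₂ : LightRay K} (h : r₁.s ≠ r₂.s) :
    Meet r₁ r₂ ↔ r₂.v - r₁.v = (r₂.u - r₁.u) * (r₁.s + r₂.s) := by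
  have h0 : r₁.s - r₂.s ≠ 0 := sub_ne_zero.2 h
  constructor
  · rintro ⟨t, ht⟩
    have h1 := congrFun ht 1
    have h2 := congrFun ht 2
    simp only [pt_one, pt_two] at h1 h2
    linear_combination (r₁.s + r₂.s) * h1 - h2
  · intro hv
    refine ⟨(r₂.u - r₁.u) / (r₁.s - r₂.s), funext fun i => ?_⟩
    fin_cases i
    · rfl
    · simp only [Fin.mk_one, pt_one]
      field_simp
      ring
    · simp only [Fin.reduceFinMk, pt_two]
      field_simp
      linear_combination (-(r₁.s - r₂.s)) * hv

theorem eq_of_meet_of_eq {K : Type*} [Field K] {r₁ r₂ : LightRay K} (h : r₁.s = r₂.s)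
    (hm : Meet r₁ r₂) : r₁.u = r₂.u ∧ r₁.v = r₂.v := by
  obtain ⟨t, ht⟩ := hm
  have h1 := congrFun ht 1
  have h2 := congrFun ht 2
  simp only [pt_one, pt_two, h, add_left_inj] at h1 h2
  exact ⟨h1, h2⟩

theorem card_le_two_of_quadratic {K : Type*} [Field K] {a b c : K} (h : a ≠ 0 ∨ b ≠ 0 ∨ c ≠ 0)
    {S : Finset K} (hS : ∀ x ∈ S, a * x ^ 2 + b * x + c = 0) : S.card ≤ 2 := by
  classical
  set q : Polynomial K := Polynomial.C a * Polynomial.X ^ 2 + Polynomial.C b * Polynomial.X +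
    Polynomial.C c with hq
  have hq0 : q ≠ 0 := by
    intro h0
    have e0 : q.coeff 0 = c := by simp [hq]
    have e1 : q.coeff 1 = b := by simp [hq, Polynomial.coeff_C]
    have e2 : q.coeff 2 = a := by simp [hq]
    simp only [h0, Polynomial.coeff_zero] at e0 e1 e2
    simp [← e0, ← e1, ← e2] at h
  calc S.card ≤ q.natDegree := by
        refine Polynomial.card_le_degree_of_subset_roots fun x hx => ?_
        rw [Polynomial.mem_roots hq0, Polynomial.IsRoot]
        simpa [hq] using hS x hx
    _ ≤ 2 := Polynomial.natDegree_quadratic_le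

section Energy

variable {F K : Type*} [Field F] [Field K] [Algebra F K]

/-- The ray attached to `y` and the line `x = a y + b`, in the first family. -/
def rayLeft (θ : K) (q : F × F × F) : LightRay K where
  s := algebraMap F K q.1 + θ
  u := algebraMap F K q.2.1 + θ ^ 2
  v := -algebraMap F K q.2.2 + (algebraMap F K q.2.1 + θ ^ 2) * (algebraMap F K q.1 + θ)

/-- The ray attached to `y` and the line `x = a y + b`, in the second family. -/
def rayRight (θ : K) (q : F × F × F) : LightRay K where
  s := algebraMap F K q.1
  u := algebraMap F K q.2.1
  v := -(algebraMap F K q.2.2 - algebraMap F K q.2.1 * θ + algebraMap F K q.1 * θ ^ 2) +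
    algebraMap F K q.2.1 * algebraMap F K q.1

/-- `1, θ, θ ^ 2` are linearly independent over `F`. -/
def IndepPowers (F : Type*) {K : Type*} [Field F] [Field K] [Algebra F K] (θ : K) : Prop :=
  ∀ a b c : F, algebraMap F K a + algebraMap F K b * θ + algebraMap F K c * θ ^ 2 = 0 →
    a = 0 ∧ b = 0 ∧ c = 0

variable {θ : K}

theorem rayLeft_s_ne (hθ : IndepPowers F θ) (q q' : F × F × F) :
    (rayLeft θ q).s ≠ (rayRight θ q').s := by
  intro h
  have := (hθ (q.1 - q'.1) 1 0 (by
    simp only [rayLeft, rayRight] at h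
    simp only [map_sub, map_one, map_zero]
    linear_combination h)).2.1
  exact one_ne_zero this

theorem meet_rayLeft_rayRight (hθ : IndepPowers F θ) (y y' a b a' b' : F) :
    Meet (rayLeft θ (y, a', b')) (rayRight θ (y', a, b)) ↔ a * y + b = a' * y' + b' := by
  rw [meet_iff_of_ne (rayLeft_s_ne hθ _ _), ← (algebraMap F K).injective.eq_iff]
  simp only [rayLeft, rayRight, map_add, map_mul]
  constructor <;> intro h <;> linear_combination -h

theorem eq_of_meet_rayLeft (hθ : IndepPowers F θ) {q q' : F × F × F}
    (h : Meet (rayLeft θ q) (rayLeft θ q')) : q = q' := by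
  obtain ⟨y, a, b⟩ := q
  obtain ⟨y', a', b'⟩ := q'
  have hinj := (algebraMap F K).injective
  by_cases hy : y = y'
  · subst hy
    obtain ⟨h1, h2⟩ := eq_of_meet_of_eq (r₁ := rayLeft θ (y, a, b))
      (r₂ := rayLeft θ (y, a', b')) rfl h
    simp only [rayLeft, add_left_inj] at h1 h2
    rw [h1] at h2
    simp only [add_left_inj, neg_inj] at h2
    rw [hinj h1, hinj h2]
  · refine absurd ?_ hy
    have hs : (rayLeft θ (y, a, b)).s ≠ (rayLeft θ (y', a', b')).s := by
      simpa [rayLeft] using fun h => hy h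
    rw [meet_iff_of_ne hs] at h
    simp only [rayLeft] at h
    refine sub_eq_zero.1 (hθ (a' * y - a * y' + b' - b) (a' - a) (y - y') ?_).2.2
    simp only [map_sub, map_add, map_mul]
    linear_combination -h

theorem eq_of_meet_rayRight (hθ : IndepPowers F θ) {q q' : F × F × F}
    (h : Meet (rayRight θ q) (rayRight θ q')) : q = q' := by
  obtain ⟨y, a, b⟩ := q
  obtain ⟨y', a', b'⟩ := q'
  have hinj := (algebraMap F K).injective
  by_cases hy : y = y'
  · subst hy
    obtain ⟨h1, h2⟩ := eq_of_meet_of_eq (r₁ := rayRight θ (y, a, b))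
      (r₂ := rayRight θ (y, a', b')) rfl h
    simp only [rayRight] at h1 h2
    rw [h1] at h2
    simp only [add_left_inj, neg_inj, sub_left_inj] at h2
    rw [hinj h1, hinj h2]
  · refine absurd ?_ hy
    have hs : (rayRight θ (y, a, b)).s ≠ (rayRight θ (y', a', b')).s := by
      simpa [rayRight] using fun h => hy h
    rw [meet_iff_of_ne hs] at h
    simp only [rayRight] at h
    refine sub_eq_zero.1 (hθ (b - b' + a' * y' - a * y - (a' - a) * (y + y')) (a' - a)
      (y - y') ?_).2.2
    simp only [map_sub, map_add, map_mul]
    linear_combination h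

theorem rayLeft_injective (hθ : IndepPowers F θ) :
    Function.Injective (rayLeft θ : F × F × F → LightRay K) :=
  fun _ _ h => eq_of_meet_rayLeft hθ ⟨0, by rw [h]⟩

theorem rayRight_injective (hθ : IndepPowers F θ) :
    Function.Injective (rayRight θ : F × F × F → LightRay K) :=
  fun _ _ h => eq_of_meet_rayRight hθ ⟨0, by rw [h]⟩

variable [DecidableEq F]

/-- At most `κ` members of `L` lie on any line of the plane. -/
def LineBounded (κ : ℕ) (L : Finset (F × F)) : Prop :=
  ∀ α β γ : F, (α ≠ 0 ∨ β ≠ 0) → (L.filter fun l => α * l.1 + β * l.2 = γ).card ≤ κ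

/-- A line over an extension field meets the plane `F^2` in a point or a line. -/
theorem LineBounded.card_le {κ : ℕ} {L : Finset (F × F)} (hL : LineBounded κ L) (hκ : 1 ≤ κ)
    {α β γ : K} (h : α ≠ 0 ∨ β ≠ 0) {S : Finset (F × F)} (hSL : S ⊆ L)
    (hS : ∀ l ∈ S, α * algebraMap F K l.1 + β * algebraMap F K l.2 = γ) : S.card ≤ κ := by
  by_cases hc : S.card ≤ 1
  · exact hc.trans hκ
  obtain ⟨l₁, h₁, l₂, h₂, hne⟩ := Finset.one_lt_card.1 (not_le.1 hc)
  refine le_trans (Finset.card_le_card fun l hl => ?_) (hL (l₂.2 - l₁.2) (-(l₂.1 - l₁.1))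
    ((l₂.2 - l₁.2) * l₁.1 - (l₂.1 - l₁.1) * l₁.2) ?_)
  · refine Finset.mem_filter.2 ⟨hSL hl, (algebraMap F K).injective ?_⟩
    have e₁ := hS _ h₁
    have e₂ := hS _ h₂
    have e := hS _ hl
    simp only [map_sub, map_add, map_mul, map_neg]
    rcases h with h | h <;> apply mul_left_cancel₀ h
    · linear_combination (algebraMap F K l₂.2 - algebraMap F K l₁.2) * e -
        (algebraMap F K l.2 - algebraMap F K l₁.2) * e₂ +
        (algebraMap F K l.2 - algebraMap F K l₂.2) * e₁
    · linear_combination -(algebraMap F K l₂.1 - algebraMap F K l₁.1) * e +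
        (algebraMap F K l.1 - algebraMap F K l₁.1) * e₂ -
        (algebraMap F K l.1 - algebraMap F K l₂.1) * e₁
  · by_contra! h0
    exact hne (Prod.ext (sub_eq_zero.1 (neg_eq_zero.1 h0.2)).symm (sub_eq_zero.1 h0.1).symm)

open scoped Classical in
theorem card_le_of_lies_sph {κ k : ℕ} {Y : Finset F} {L : Finset (F × F)}
    (hL : LineBounded κ L) (hκ : 1 ≤ κ) (hY : 2 * Y.card ≤ k) (hκk : 2 * κ ≤ k)
    {c : Fin 5 → K} (hc : c ≠ 0) {E : Finset (LightRay K)}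
    (hE : E ⊆ (Y ×ˢ L).image (rayLeft θ)) (hl : ∀ r ∈ E, Lies (sph c) r) : E.card ≤ k := by
  rcases E.eq_empty_or_nonempty with rfl | ⟨r₀, hr₀⟩
  · simp
  have hform : ∀ r ∈ E, ∃ y ∈ Y, ∃ l ∈ L, r = rayLeft θ (y, l) := by
    intro r hr
    obtain ⟨⟨y, l⟩, hq, rfl⟩ := Finset.mem_image.1 (hE hr)
    rw [Finset.mem_product] at hq
    exact ⟨y, hq.1, l, hq.2, rfl⟩
  by_cases h0 : c 0 = 0
  · have hne : c 1 ≠ 0 ∨ c 2 ≠ 0 ∨ c 3 ≠ 0 := by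
      by_contra! h
      obtain ⟨h1, h2, h3⟩ := h
      have := (lies_sph_iff.1 (hl r₀ hr₀)).1
      rw [h0, h2, h3] at this
      refine hc (funext fun i => ?_)
      fin_cases i <;> simp_all
    have hs : (E.image LightRay.s).card ≤ 2 := by
      refine card_le_two_of_quadratic (a := c 3) (b := c 2) (c := c 1) (by tauto) fun s hs => ?_
      obtain ⟨r, hr, rfl⟩ := Finset.mem_image.1 hs
      have := (lies_sph_iff.1 (hl r hr)).2
      rw [h0] at this
      linear_combination this
    refine le_trans (Finset.card_le_mul_card_image (f := LightRay.s) E κ fun s hs => ?_) ?_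
    · have h23 : c 2 + c 3 * s ≠ 0 ∨ -c 3 ≠ 0 := by
        by_contra! h
        have h3 : c 3 = 0 := neg_eq_zero.1 h.2
        have h2 : c 2 = 0 := by simpa [h3] using h.1
        have := (lies_sph_iff.1 (hl r₀ hr₀)).2
        rw [h0, h2, h3] at this
        simp_all
      obtain ⟨r₁, hr₁, rfl⟩ := Finset.mem_image.1 hs
      obtain ⟨y, hy, l₁, hl₁, rfl⟩ := hform r₁ hr₁
      set S := L.filter fun l => rayLeft θ (y, l) ∈ E with hS
      refine le_trans (le_trans (Finset.card_le_card ?_)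
        (Finset.card_image_le (s := S) (f := fun l => rayLeft θ (y, l)))) (hL.card_le hκ h23
          (S := S) (γ := -(c 4 + (c 2 + c 3 * (rayLeft θ (y, l₁)).s) * θ ^ 2))
          (Finset.filter_subset _ _) fun l hl' => ?_)
      · intro r hr
        rw [Finset.mem_filter] at hr
        obtain ⟨y', hy', l, hl', rfl⟩ := hform r hr.1
        have : y' = y := by simpa [rayLeft] using hr.2
        subst this
        exact Finset.mem_image.2 ⟨l, Finset.mem_filter.2 ⟨hl', hr.1⟩, rfl⟩
      · have := (lies_sph_iff.1 (hl _ (Finset.mem_filter.1 hl').2)).1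
        rw [h0] at this
        simp only [rayLeft] at this ⊢
        linear_combination this
    · calc κ * (E.image LightRay.s).card ≤ κ * 2 := Nat.mul_le_mul_left _ hs
        _ ≤ k := by omega
  · refine le_trans (Finset.card_le_mul_card_image (f := LightRay.s) E 2 fun s hs => ?_) ?_
    · have hv : ∀ r ∈ E.filter (fun r => r.s = s),
          r.v = 2 * r.u * s + (c 1 + c 2 * s + c 3 * s ^ 2) / c 0 := by
        intro r hr
        rw [Finset.mem_filter] at hr
        have := (lies_sph_iff.1 (hl r hr.1)).2
        rw [hr.2] at this
        field_simp
        linear_combination -this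
      have hinj : Set.InjOn LightRay.u (↑(E.filter fun r => r.s = s) : Set (LightRay K)) := by
        intro r hr r' hr' huu
        have h1 := (Finset.mem_filter.1 hr).2
        have h2 := (Finset.mem_filter.1 hr').2
        refine LightRay.ext (h1.trans h2.symm) huu ?_
        rw [hv r hr, hv r' hr', huu]
      rw [← Finset.card_image_of_injOn hinj]
      refine card_le_two_of_quadratic (a := c 0) (b := c 2 + c 3 * (2 * s))
        (c := c 4 + c 3 * ((c 1 + c 2 * s + c 3 * s ^ 2) / c 0)) (Or.inl h0) fun u hu => ?_
      obtain ⟨r, hr, rfl⟩ := Finset.mem_image.1 hu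
      have := (lies_sph_iff.1 (hl r (Finset.mem_filter.1 hr).1)).1
      rw [hv r hr] at this
      linear_combination this
    · have : E.image LightRay.s ⊆ Y.image fun y => algebraMap F K y + θ := by
        intro s hs
        obtain ⟨r, hr, rfl⟩ := Finset.mem_image.1 hs
        obtain ⟨y, hy, l, -, rfl⟩ := hform r hr
        exact Finset.mem_image.2 ⟨y, hy, rfl⟩
      have := (Finset.card_le_card this).trans Finset.card_image_le
      omega

/-- The number of coincidences `l(y) = l'(y')` with `y, y' ∈ Y` and `l, l' ∈ L`, where
`l = (a, b)` stands for the map `y ↦ a y + b`. -/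
def energy (Y : Finset F) (L : Finset (F × F)) : ℕ :=
  (((Y ×ˢ L) ×ˢ (Y ×ˢ L)).filter fun q =>
    q.1.2.1 * q.1.1 + q.1.2.2 = q.2.2.1 * q.2.1 + q.2.2.2).card

theorem energy_le_of_indepPowers [Infinite K] (hθ : IndepPowers F θ) {p : ℕ} [Fact p.Prime]
    [CharP K p] {n κ k : ℕ} (hn : n ≤ p) {Y : Finset F} {L : Finset (F × F)}
    (hL : LineBounded κ L) (hκ : 1 ≤ κ) (hY : 2 * Y.card ≤ k) (hκk : 2 * κ ≤ k)
    (hYL : Y.card * L.card ≤ n ^ 2) :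
    energy Y L ≤ 40000 * n ^ 3 + k * (Y.card * L.card) := by
  classical
  have hA : Admissible k ((Y ×ˢ L).image (rayLeft θ)) ((Y ×ˢ L).image (rayRight θ)) := by
    constructor
    · intro r₁ h₁ r₂ h₂ h
      obtain ⟨q₁, -, rfl⟩ := Finset.mem_image.1 h₁
      obtain ⟨q₂, -, rfl⟩ := Finset.mem_image.1 h₂
      rw [eq_of_meet_rayLeft hθ h]
    · intro r₁ h₁ r₂ h₂ h
      obtain ⟨q₁, -, rfl⟩ := Finset.mem_image.1 h₁
      obtain ⟨q₂, -, rfl⟩ := Finset.mem_image.1 h₂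
      rw [eq_of_meet_rayRight hθ h]
    · intro r₁ h₁ r₂ h₂
      obtain ⟨q₁, -, rfl⟩ := Finset.mem_image.1 h₁
      obtain ⟨q₂, -, rfl⟩ := Finset.mem_image.1 h₂
      exact rayLeft_s_ne hθ _ _
    · intro c hc E hE hl
      exact card_le_of_lies_sph hL hκ hY hκk hc (by convert hE) hl
  have hc : ∀ f : F × F × F → LightRay K, ((Y ×ˢ L).image f).card ≤ Y.card * L.card := by
    intro f
    rw [← Finset.card_product]
    exact Finset.card_image_le
  refine le_trans (le_trans ?_ (meets_le n hn hA ((hc _).trans hYL) ((hc _).trans hYL)))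
    (Nat.add_le_add_left (Nat.mul_le_mul_left _ (hc _)) _)
  refine Finset.card_le_card_of_injOn
    (fun q => (rayLeft θ (q.1.1, q.2.2), rayRight θ (q.2.1, q.1.2))) ?_ ?_
  · rintro ⟨⟨y, a, b⟩, ⟨y', a', b'⟩⟩ hq
    simp only [Finset.coe_filter, Finset.mem_product, Set.mem_ofPred_eq] at hq
    simp only [Finset.coe_filter, Finset.mem_product, Set.mem_ofPred_eq,
      meet_rayLeft_rayRight hθ, hq.2, and_true]
    exact ⟨Finset.mem_image_of_mem _ (Finset.mem_product.2 ⟨hq.1.1.1, hq.1.2.2⟩),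
      Finset.mem_image_of_mem _ (Finset.mem_product.2 ⟨hq.1.2.1, hq.1.1.2⟩)⟩
  · rintro ⟨⟨y, l⟩, ⟨y', l'⟩⟩ - ⟨⟨z, m⟩, ⟨z', m'⟩⟩ - h
    simp only [Prod.mk.injEq] at h
    have h1 := rayLeft_injective hθ h.1
    have h2 := rayRight_injective hθ h.2
    simp_all

end Energy

theorem indepPowers_ratFunc_X (F : Type*) [Field F] : IndepPowers F (RatFunc.X : RatFunc F) := by
  intro a b c h
  have key : algebraMap (Polynomial F) (RatFunc F) (Polynomial.C a +
      Polynomial.C b * Polynomial.X + Polynomial.C c * Polynomial.X ^ 2) = 0 := by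
    simpa [← RatFunc.algebraMap_eq_C] using h
  rw [map_eq_zero_iff _ (RatFunc.algebraMap_injective F)] at key
  refine ⟨?_, ?_, ?_⟩
  · simpa [Polynomial.coeff_X, Polynomial.coeff_C] using congrArg (Polynomial.coeff · 0) key
  · simpa [Polynomial.coeff_X, Polynomial.coeff_C] using congrArg (Polynomial.coeff · 1) key
  · simpa [Polynomial.coeff_X, Polynomial.coeff_C] using congrArg (Polynomial.coeff · 2) key

theorem energy_le {p : ℕ} [Fact p.Prime] {n κ k : ℕ} (hn : n ≤ p) {Y : Finset (ZMod p)}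
    {L : Finset (ZMod p × ZMod p)} (hL : LineBounded κ L) (hκ : 1 ≤ κ) (hY : 2 * Y.card ≤ k)
    (hκk : 2 * κ ≤ k) (hYL : Y.card * L.card ≤ n ^ 2) :
    energy Y L ≤ 40000 * n ^ 3 + k * (Y.card * L.card) := by
  have : Infinite (RatFunc (ZMod p)) :=
    Infinite.of_injective _ (RatFunc.algebraMap_injective (ZMod p))
  have : CharP (RatFunc (ZMod p)) p :=
    charP_of_injective_algebraMap (algebraMap (ZMod p) (RatFunc (ZMod p))).injective p
  exact energy_le_of_indepPowers (indepPowers_ratFunc_X (ZMod p)) hn hL hκ hY hκk hYL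

end

section

section Hits

variable {F : Type*} [Field F] [DecidableEq F]

/-- The number of pairs `(y, l) ∈ Y × L` with `l(y) ∈ D`, where `l = (a, b)` stands for the map
`y ↦ a y + b`. -/
def hits (Y : Finset F) (L : Finset (F × F)) (D : Finset F) : ℕ :=
  ((Y ×ˢ L).filter fun q => q.2.1 * q.1 + q.2.2 ∈ D).card

theorem hits_le_card_mul_card (Y : Finset F) (L : Finset (F × F)) (D : Finset F) :
    hits Y L D ≤ Y.card * L.card := by
  rw [← Finset.card_product]
  exact Finset.card_filter_le _ _

theorem hits_sq_le (Y : Finset F) (L : Finset (F × F)) (D : Finset F) :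
    hits Y L D ^ 2 ≤ D.card * energy Y L := by
  set S := Y ×ˢ L
  set φ : F × F × F → F := fun q => q.2.1 * q.1 + q.2.2
  have h1 : hits Y L D = ∑ d ∈ D, (S.filter fun q => φ q = d).card := by
    rw [hits, Finset.card_eq_sum_card_fiberwise (f := φ) (t := D)]
    · refine Finset.sum_congr rfl fun d hd => ?_
      congr 1
      ext q
      simp only [Finset.mem_filter, φ, S]
      constructor
      · rintro ⟨⟨h, -⟩, h'⟩
        exact ⟨h, h'⟩
      · rintro ⟨h, h'⟩
        exact ⟨⟨h, h' ▸ hd⟩, h'⟩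
    · intro q hq
      exact (Finset.mem_filter.1 hq).2
  have h2 : ∑ d ∈ D, (S.filter fun q => φ q = d).card ^ 2 ≤ energy Y L := by
    simp only [sq, ← Finset.card_product]
    rw [← Finset.card_biUnion]
    · refine Finset.card_le_card fun q hq => ?_
      obtain ⟨d, -, hq⟩ := Finset.mem_biUnion.1 hq
      simp only [Finset.mem_product, Finset.mem_filter, φ] at hq ⊢
      exact ⟨⟨Finset.mem_product.1 hq.1.1, Finset.mem_product.1 hq.2.1⟩,
        hq.1.2.trans hq.2.2.symm⟩
    · refine fun d _ d' _ hne => Finset.disjoint_left.2 fun q hq hq' => hne ?_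
      simp only [Finset.mem_product, Finset.mem_filter] at hq hq'
      exact hq.1.2.symm.trans hq'.1.2
  rw [h1]
  exact sq_sum_le_card_mul_sum_sq.trans (Nat.mul_le_mul_left _ h2)

theorem hits_le_of_line {Y : Finset F} {M : Finset (F × F)} (D : Finset F) {α β γ : F}
    (h : α ≠ 0 ∨ β ≠ 0) (hM : ∀ l ∈ M, α * l.1 + β * l.2 = γ) :
    hits Y M D ≤ M.card + D.card * Y.card := by
  rw [hits, ← Finset.card_filter_add_card_filter_not (fun q => α = β * q.1)]
  refine Nat.add_le_add ?_ ?_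
  · refine Finset.card_le_card_of_injOn Prod.snd ?_ ?_
    · intro q hq
      simp only [Finset.coe_filter, Finset.mem_filter, Finset.mem_product, Set.mem_ofPred_eq] at hq
      exact hq.1.1.2
    · rintro ⟨y, l⟩ hq ⟨y', l'⟩ hq' (rfl : l = l')
      simp only [Finset.coe_filter, Finset.mem_filter, Finset.mem_product,
        Set.mem_ofPred_eq] at hq hq'
      have hβ : β ≠ 0 := by
        rintro rfl
        simp_all
      have := mul_left_cancel₀ hβ (hq.2.symm.trans hq'.2)
      rw [this]
  · rw [← Finset.card_product]
    refine Finset.card_le_card_of_injOn (fun q => (q.2.1 * q.1 + q.2.2, q.1)) ?_ ?_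
    · intro q hq
      simp only [Finset.coe_filter, Finset.mem_filter, Finset.mem_product, Set.mem_ofPred_eq] at hq
      exact Finset.mem_coe.2 (Finset.mem_product.2 ⟨hq.1.2, hq.1.1.1⟩)
    · rintro ⟨y, a, b⟩ hq ⟨y', a', b'⟩ hq' h'
      simp only [Finset.coe_filter, Finset.mem_filter, Finset.mem_product,
        Set.mem_ofPred_eq] at hq hq'
      simp only [Prod.mk.injEq] at h'
      obtain ⟨h', rfl⟩ := h'
      have e := hM _ hq.1.1.2
      have e' := hM _ hq'.1.1.2
      have ha : a = a' := by
        apply mul_left_cancel₀ (sub_ne_zero.2 hq.2)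
        linear_combination e - e' - β * h'
      subst ha
      rw [add_right_inj] at h'
      rw [h']

theorem hits_split (P : F × F → Prop) [DecidablePred P] (Y : Finset F) (L : Finset (F × F))
    (D : Finset F) :
    hits Y L D = hits Y (L.filter P) D + hits Y (L.filter fun l => ¬ P l) D := by
  simp only [hits]
  rw [← Finset.card_filter_add_card_filter_not (fun q => P q.2)]
  congr 2 <;> ext q <;> simp only [Finset.mem_filter, Finset.mem_product] <;> tauto

theorem hits_le_of_lineBounded {Y D : Finset F} {n B : ℕ} (L : Finset (F × F))
    (hB : ∀ L' ⊆ L, LineBounded n L' → hits Y L' D ≤ B) :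
    n * hits Y L D ≤ n * B + n * L.card + L.card * (D.card * Y.card) := by
  induction L using Finset.strongInduction with
  | H L ih =>
    by_cases hL : LineBounded n L
    · have := Nat.mul_le_mul_left n (hB L subset_rfl hL)
      omega
    · simp only [LineBounded, not_forall, not_le] at hL
      obtain ⟨α, β, γ, h, hn⟩ := hL
      set P : F × F → Prop := fun l => α * l.1 + β * l.2 = γ
      have hss : L.filter (fun l => ¬ P l) ⊂ L := by
        rw [Finset.filter_ssubset]
        obtain ⟨l, hl⟩ := Finset.card_pos.1 ((Nat.zero_le n).trans_lt hn : 0 < (L.filter P).card)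
        exact ⟨l, (Finset.mem_filter.1 hl).1, not_not.2 (Finset.mem_filter.1 hl).2⟩
      have h1 := ih _ hss fun L' hL' => hB L' (hL'.trans hss.1)
      have h2 : hits Y (L.filter P) D ≤ _ :=
        hits_le_of_line D h fun l hl => (Finset.mem_filter.1 hl).2
      have h3 := Finset.card_filter_add_card_filter_not (s := L) P
      rw [hits_split P, ← h3]
      have h4 := Nat.mul_le_mul_left n h2
      have h5 := Nat.mul_le_mul_right (D.card * Y.card) hn.le
      nlinarith

end Hits

section Bounds

variable {p : ℕ} [Fact p.Prime]

theorem hits_le_aux {n : ℕ} (hn : n ≤ p) (hn1 : 1 ≤ n) {Y D : Finset (ZMod p)}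
    {L : Finset (ZMod p × ZMod p)} (hYL : Y.card * L.card ≤ n ^ 2) :
    (hits Y L D : ℝ) ≤ √(D.card * (40002 * n ^ 3 + 2 * Y.card * (Y.card * L.card))) + L.card +
      D.card * n := by
  set Q : ℕ := D.card * (40002 * n ^ 3 + 2 * Y.card * (Y.card * L.card)) with hQ
  have key : n * hits Y L D ≤ n * Nat.sqrt Q + n * L.card + L.card * (D.card * Y.card) := by
    refine hits_le_of_lineBounded L fun L' hL' hb => ?_
    rw [Nat.le_sqrt']
    have hc := Finset.card_le_card hL'
    have hYL' : Y.card * L'.card ≤ Y.card * L.card := Nat.mul_le_mul_left _ hc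
    have he := energy_le (k := 2 * (Y.card + n)) hn hb hn1 (by omega) (by omega) (hYL'.trans hYL)
    refine (hits_sq_le Y L' D).trans (Nat.mul_le_mul_left _ (he.trans ?_))
    calc 40000 * n ^ 3 + 2 * (Y.card + n) * (Y.card * L'.card)
        ≤ 40000 * n ^ 3 + 2 * (Y.card + n) * (Y.card * L.card) := by gcongr
      _ = 40000 * n ^ 3 + 2 * n * (Y.card * L.card) + 2 * Y.card * (Y.card * L.card) := by ring
      _ ≤ 40000 * n ^ 3 + 2 * n * n ^ 2 + 2 * Y.card * (Y.card * L.card) := by gcongr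
      _ = _ := by ring
  have key' : hits Y L D ≤ Nat.sqrt Q + L.card + D.card * n := by
    refine Nat.le_of_mul_le_mul_left ?_ hn1
    have : L.card * (D.card * Y.card) ≤ D.card * n ^ 2 := by
      calc L.card * (D.card * Y.card) = D.card * (Y.card * L.card) := by ring
        _ ≤ _ := by gcongr
    nlinarith
  have hQ' : (Nat.sqrt Q : ℝ) ≤
      √(D.card * (40002 * n ^ 3 + 2 * Y.card * (Y.card * L.card))) := by
    have : ((D.card : ℝ) * (40002 * n ^ 3 + 2 * Y.card * (Y.card * L.card))) = (Q : ℝ) := by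
      rw [hQ]; push_cast; ring
    rw [this]
    exact Real.nat_sqrt_le_real_sqrt
  have : (hits Y L D : ℝ) ≤ Nat.sqrt Q + L.card + D.card * n := by exact_mod_cast key'
  linarith

/-- The number of pairs `(y, l) ∈ Y × L` with `l(y) ∈ D`. -/
theorem hits_le (Y D : Finset (ZMod p)) (L : Finset (ZMod p × ZMod p))
    (hYL : Y.card * L.card ≤ p ^ 2) :
    (hits Y L D : ℝ) ≤ 600 * ((D.card : ℝ) ^ (1 / 2 : ℝ) * ((Y.card : ℝ) * L.card) ^ (3 / 4 : ℝ) +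
      D.card * ((Y.card : ℝ) * L.card) ^ (1 / 2 : ℝ) +
      (D.card : ℝ) ^ (1 / 2 : ℝ) * (Y.card * (L.card : ℝ) ^ (1 / 2 : ℝ)) + L.card) := by
  rcases Nat.eq_zero_or_pos (Y.card * L.card) with h0 | hpos
  · have : hits Y L D = 0 := Nat.le_zero.1 ((hits_le_card_mul_card Y L D).trans h0.le)
    rw [this, Nat.cast_zero]
    positivity
  set N : ℝ := (Y.card : ℝ) * L.card with hN
  have hN1 : 1 ≤ N := by rw [hN]; exact_mod_cast hpos
  have hN0 : 0 ≤ N := by linarith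
  set n := ⌈√N⌉₊ with hn
  have hnp : n ≤ p := by
    rw [hn, Nat.ceil_le, Real.sqrt_le_left (by positivity), hN]
    exact_mod_cast hYL
  have hr1 : 1 ≤ √N := Real.one_le_sqrt.2 hN1
  have hnr : (n : ℝ) ≤ 2 * √N := by
    have := Nat.ceil_lt_add_one (Real.sqrt_nonneg N)
    linarith
  have hrn : √N ≤ n := Nat.le_ceil _
  have hr2 : √N ^ 2 = N := Real.sq_sqrt hN0
  have hn1 : 1 ≤ n := by
    have : (1 : ℝ) ≤ n := hr1.trans hrn
    exact_mod_cast this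
  have hYL' : Y.card * L.card ≤ n ^ 2 := by
    have : N ≤ (n : ℝ) ^ 2 := by rw [← hr2]; gcongr
    rw [hN] at this
    exact_mod_cast this
  have hmain := hits_le_aux (D := D) hnp hn1 hYL'
  rw [← Real.sqrt_eq_rpow, ← Real.sqrt_eq_rpow, ← Real.sqrt_eq_rpow]
  set w := N ^ (3 / 4 : ℝ) with hw
  have hw2 : w ^ 2 = √N ^ 3 := by
    rw [hw, Real.sqrt_eq_rpow, ← Real.rpow_natCast, ← Real.rpow_natCast, ← Real.rpow_mul hN0,
      ← Real.rpow_mul hN0]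
    norm_num
  have hw0 : 0 ≤ w := by positivity
  have hd2 : √(D.card : ℝ) ^ 2 = D.card := Real.sq_sqrt (Nat.cast_nonneg _)
  have hl2 : √(L.card : ℝ) ^ 2 = L.card := Real.sq_sqrt (Nat.cast_nonneg _)
  have hsq : √(D.card * (40002 * n ^ 3 + 2 * Y.card * (Y.card * L.card)) : ℝ) ≤
      600 * (√(D.card : ℝ) * w) + 2 * (√(D.card : ℝ) * (Y.card * √(L.card : ℝ))) := by
    refine Real.sqrt_le_iff.2 ⟨by positivity, ?_⟩
    have e1 : (n : ℝ) ^ 3 ≤ 8 * w ^ 2 := by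
      calc (n : ℝ) ^ 3 ≤ (2 * √N) ^ 3 := by gcongr
        _ = 8 * w ^ 2 := by rw [hw2]; ring
    have e2 : (2 * Y.card * (Y.card * L.card) : ℝ) = 2 * (Y.card * √(L.card : ℝ)) ^ 2 := by
      rw [mul_pow, hl2]; ring
    have e3 : 0 ≤ w * (Y.card * √(L.card : ℝ)) := by positivity
    calc (D.card * (40002 * n ^ 3 + 2 * Y.card * (Y.card * L.card)) : ℝ)
        ≤ D.card * (40002 * (8 * w ^ 2) + 2 * (Y.card * √(L.card : ℝ)) ^ 2) := by
          rw [e2]; gcongr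
      _ ≤ D.card * (600 * w + 2 * (Y.card * √(L.card : ℝ))) ^ 2 := by
          gcongr
          nlinarith [sq_nonneg w, sq_nonneg (Y.card * √(L.card : ℝ))]
      _ = _ := by nth_rewrite 1 [← hd2]; ring
  have h3 : (D.card : ℝ) * n ≤ 2 * (D.card * √N) := by
    calc (D.card : ℝ) * n ≤ D.card * (2 * √N) := by gcongr
      _ = _ := by ring
  have p1 : 0 ≤ √(D.card : ℝ) * (Y.card * √(L.card : ℝ)) := by positivity
  have p2 : 0 ≤ (D.card : ℝ) * √N := by positivity
  have p3 : (0 : ℝ) ≤ L.card := by positivity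
  linarith

end Bounds

end

section

section Swap

variable {F : Type*} [Field F] [DecidableEq F]

theorem hits_le_swap (Y D : Finset F) (L : Finset (F × F)) :
    hits Y L D ≤ Y.card * D.card +
      hits D ((L.filter fun l => ¬ l.1 = 0).image fun l => (l.1⁻¹, -l.2 * l.1⁻¹)) Y := by
  rw [hits_split fun l => l.1 = 0]
  refine Nat.add_le_add ?_ ?_
  · rw [← Finset.card_product]
    refine Finset.card_le_card_of_injOn (fun q => (q.1, q.2.2)) ?_ ?_
    · rintro ⟨y, a, b⟩ hq
      simp only [Finset.coe_filter, Finset.mem_filter, Finset.mem_product,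
        Set.mem_ofPred_eq] at hq
      refine Finset.mem_coe.2 (Finset.mem_product.2 ⟨hq.1.1, ?_⟩)
      simpa [hq.1.2.2] using hq.2
    · rintro ⟨y, a, b⟩ hq ⟨y', a', b'⟩ hq' h
      simp only [Finset.coe_filter, Finset.mem_filter, Finset.mem_product,
        Set.mem_ofPred_eq] at hq hq'
      simp_all
  · refine Finset.card_le_card_of_injOn
      (fun q => (q.2.1 * q.1 + q.2.2, (q.2.1⁻¹, -q.2.2 * q.2.1⁻¹))) ?_ ?_
    · rintro ⟨y, a, b⟩ hq
      simp only [Finset.coe_filter, Finset.mem_filter, Finset.mem_product,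
        Set.mem_ofPred_eq] at hq
      have ha := hq.1.2.2
      refine Finset.mem_coe.2 (Finset.mem_filter.2 ⟨Finset.mem_product.2 ⟨hq.2,
        Finset.mem_image.2 ⟨(a, b), Finset.mem_filter.2 hq.1.2, rfl⟩⟩, ?_⟩)
      convert hq.1.1 using 1
      field_simp
      ring
    · rintro ⟨y, a, b⟩ hq ⟨y', a', b'⟩ hq' h
      simp only [Finset.coe_filter, Finset.mem_filter, Finset.mem_product,
        Set.mem_ofPred_eq] at hq hq'
      simp only [Prod.mk.injEq, inv_inj] at h
      obtain ⟨h1, rfl, h2⟩ := h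
      have ha := hq.1.2.2
      have hb := neg_inj.1 (mul_right_cancel₀ (inv_ne_zero ha) h2)
      subst hb
      rw [mul_left_cancel₀ ha (add_right_cancel h1)]

end Swap

theorem rpow_half_mul_rpow_le {a b c : ℝ} (ha : 0 ≤ a) (hab : a ≤ b) (hc : 0 ≤ c) :
    b ^ (1 / 2 : ℝ) * (a * c) ^ (3 / 4 : ℝ) ≤ a ^ (1 / 2 : ℝ) * (b * c) ^ (3 / 4 : ℝ) := by
  have hb := ha.trans hab
  have e : ∀ x : ℝ, 0 ≤ x → x ^ (3 / 4 : ℝ) = x ^ (1 / 2 : ℝ) * x ^ (1 / 4 : ℝ) := fun x hx => by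
    rw [← Real.rpow_add_of_nonneg hx (by norm_num) (by norm_num)]
    norm_num
  rw [Real.mul_rpow ha hc, Real.mul_rpow hb hc, e a ha, e b hb]
  have : a ^ (1 / 4 : ℝ) ≤ b ^ (1 / 4 : ℝ) := by gcongr
  calc b ^ (1 / 2 : ℝ) * (a ^ (1 / 2 : ℝ) * a ^ (1 / 4 : ℝ) * c ^ (3 / 4 : ℝ))
      = (a ^ (1 / 2 : ℝ) * b ^ (1 / 2 : ℝ) * c ^ (3 / 4 : ℝ)) * a ^ (1 / 4 : ℝ) := by ring
    _ ≤ (a ^ (1 / 2 : ℝ) * b ^ (1 / 2 : ℝ) * c ^ (3 / 4 : ℝ)) * b ^ (1 / 4 : ℝ) := by gcongr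
    _ = _ := by ring

theorem hits_le' {p : ℕ} [Fact p.Prime] (Y D : Finset (ZMod p)) (L : Finset (ZMod p × ZMod p))
    (hYL : Y.card * L.card ≤ p ^ 2) :
    (hits Y L D : ℝ) ≤ 600 * ((Y.card : ℝ) ^ (1 / 2 : ℝ) * ((D.card : ℝ) * L.card) ^ (3 / 4 : ℝ) +
      D.card * ((Y.card : ℝ) * L.card) ^ (1 / 2 : ℝ) +
      (D.card : ℝ) ^ (1 / 2 : ℝ) * (Y.card * (L.card : ℝ) ^ (1 / 2 : ℝ)) + L.card +
      D.card * Y.card) := by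
  rcases le_total Y.card D.card with hc | hc
  · have h1 := hits_le Y D L hYL
    have h2 := rpow_half_mul_rpow_le (a := Y.card) (b := D.card) (c := L.card)
      (by positivity) (by exact_mod_cast hc) (by positivity)
    have h3 : (0 : ℝ) ≤ D.card * Y.card := by positivity
    linarith
  · set L' := (L.filter fun l => ¬ l.1 = 0).image fun l => (l.1⁻¹, -l.2 * l.1⁻¹) with hL'
    have hLL : L'.card ≤ L.card := Finset.card_image_le.trans (Finset.card_filter_le _ _)
    have hLL' : (L'.card : ℝ) ≤ L.card := by exact_mod_cast hLL
    have h1 := hits_le D Y L' ((Nat.mul_le_mul hc hLL).trans hYL)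
    have h2 : (hits Y L D : ℝ) ≤ Y.card * D.card + hits D L' Y := by
      exact_mod_cast hits_le_swap Y D L
    have h3 : (0 : ℝ) ≤ D.card * Y.card := by positivity
    have e1 : (Y.card : ℝ) ^ (1 / 2 : ℝ) * ((D.card : ℝ) * L'.card) ^ (3 / 4 : ℝ) ≤
        (Y.card : ℝ) ^ (1 / 2 : ℝ) * ((D.card : ℝ) * L.card) ^ (3 / 4 : ℝ) := by gcongr
    have e2 : (Y.card : ℝ) * ((D.card : ℝ) * L'.card) ^ (1 / 2 : ℝ) ≤
        (D.card : ℝ) ^ (1 / 2 : ℝ) * (Y.card * (L.card : ℝ) ^ (1 / 2 : ℝ)) := by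
      calc (Y.card : ℝ) * ((D.card : ℝ) * L'.card) ^ (1 / 2 : ℝ)
          ≤ (Y.card : ℝ) * ((D.card : ℝ) * L.card) ^ (1 / 2 : ℝ) := by gcongr
        _ = _ := by rw [Real.mul_rpow (by positivity) (by positivity)]; ring
    have e3 : (Y.card : ℝ) ^ (1 / 2 : ℝ) * (D.card * (L'.card : ℝ) ^ (1 / 2 : ℝ)) ≤
        D.card * ((Y.card : ℝ) * L.card) ^ (1 / 2 : ℝ) := by
      calc (Y.card : ℝ) ^ (1 / 2 : ℝ) * (D.card * (L'.card : ℝ) ^ (1 / 2 : ℝ))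
          ≤ (Y.card : ℝ) ^ (1 / 2 : ℝ) * (D.card * (L.card : ℝ) ^ (1 / 2 : ℝ)) := by gcongr
        _ = _ := by rw [Real.mul_rpow (by positivity) (by positivity)]; ring
    linarith

section Reduction

variable {F : Type*} [Field F] [DecidableEq F]

/-- The point `z = (x, y)` lies on the line `x = a y + b`, where `l = (a, b)`. -/
abbrev On (z l : F × F) : Prop := z.1 = l.1 * z.2 + l.2

/-- The number of lines in `L` through `z`. -/
def deg (L : Finset (F × F)) (z : F × F) : ℕ := (L.filter fun l => On z l).card

/-- The number of points of `Z` on `l`. -/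
def rich (Z : Finset (F × F)) (l : F × F) : ℕ := (Z.filter fun z => On z l).card

/-- The number of incidences between the points `Z` and the lines `L`. -/
def inc (Z L : Finset (F × F)) : ℕ := ∑ z ∈ Z, deg L z

theorem inc_eq_sum_rich (Z L : Finset (F × F)) : inc Z L = ∑ l ∈ L, rich Z l :=
  Finset.sum_card_bipartiteAbove_eq_sum_card_bipartiteBelow _

theorem three_le_mul_add {u v : ℝ} (hu : 0 < u) (hv : 0 < v) : 3 ≤ u * v + 1 / u + 1 / v := by
  have h : 0 ≤ u * v + 1 / u + 1 / v - 3 := by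
    have : u * v + 1 / u + 1 / v - 3 = ((u * v) ^ 2 + u + v - 3 * (u * v)) / (u * v) := by
      field_simp
      ring
    rw [this]
    apply div_nonneg _ (by positivity)
    have hu2 := Real.sq_sqrt hu.le
    have hv2 := Real.sq_sqrt hv.le
    set a := √u
    set b := √v
    have hab : 0 ≤ a * b := by positivity
    rw [← hu2, ← hv2]
    nlinarith [sq_nonneg (a - b), mul_nonneg (mul_nonneg hab (sq_nonneg (a * b - 1)))
      (by linarith : 0 ≤ a * b + 2)]
  linarith

/-- A lower bound for the number of paths of length three in the incidence graph. -/
theorem inc_pow_three_le (Z L : Finset (F × F)) :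
    (inc Z L : ℝ) ^ 3 ≤
      Z.card * L.card * ∑ z ∈ Z, ∑ l ∈ L with On z l, (rich Z l : ℝ) * deg L z := by
  rcases Nat.eq_zero_or_pos (inc Z L) with h0 | hpos
  · rw [h0]
    simp only [CharP.cast_eq_zero, ne_eq, OfNat.ofNat_ne_zero, not_false_eq_true, zero_pow]
    positivity
  have hi : (0 : ℝ) < inc Z L := by exact_mod_cast hpos
  have hZ : (0 : ℝ) < Z.card := by
    rw [Nat.cast_pos, Finset.card_pos, Finset.nonempty_iff_ne_empty]
    rintro rfl
    simp [inc] at hpos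
  have hL : (0 : ℝ) < L.card := by
    rw [Nat.cast_pos, Finset.card_pos, Finset.nonempty_iff_ne_empty]
    rintro rfl
    simp [inc, deg] at hpos
  set i : ℝ := ((inc Z L : ℕ) : ℝ) with hidef
  set W := ∑ z ∈ Z, ∑ l ∈ L with On z l, (rich Z l : ℝ) * deg L z with hW
  have key : ∑ z ∈ Z, ∑ l ∈ L with On z l, (3 : ℝ) ≤ ∑ z ∈ Z, ∑ l ∈ L with On z l,
      ((rich Z l : ℝ) * deg L z * (Z.card * L.card / i ^ 2) + i / L.card * (1 / rich Z l) +
        i / Z.card * (1 / deg L z)) := by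
    refine Finset.sum_le_sum fun z hz => Finset.sum_le_sum fun l hl => ?_
    obtain ⟨hl, hon⟩ := Finset.mem_filter.1 hl
    have hr : (0 : ℝ) < rich Z l := by
      exact_mod_cast Finset.card_pos.2 ⟨z, Finset.mem_filter.2 ⟨hz, hon⟩⟩
    have hd : (0 : ℝ) < deg L z := by
      exact_mod_cast Finset.card_pos.2 ⟨l, Finset.mem_filter.2 ⟨hl, hon⟩⟩
    have := three_le_mul_add (u := rich Z l * L.card / i) (v := deg L z * Z.card / i)
      (by positivity) (by positivity)
    refine this.trans_eq ?_
    field_simp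
  have h1 : ∑ z ∈ Z, ∑ l ∈ L with On z l, (3 : ℝ) = 3 * i := by
    simp only [Finset.sum_const, nsmul_eq_mul, ← Finset.sum_mul, hidef, inc, deg]
    push_cast
    ring
  have h2 : ∑ z ∈ Z, ∑ l ∈ L with On z l, (1 / (rich Z l : ℝ)) ≤ L.card := by
    rw [Finset.sum_comm' (t' := L) (s' := fun l => Z.filter fun z => On z l)
      (by intro z l; simp only [Finset.mem_filter]; tauto)]
    calc _ ≤ ∑ l ∈ L, (1 : ℝ) := Finset.sum_le_sum fun l _ => by
            rw [Finset.sum_const, nsmul_eq_mul]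
            rw [mul_one_div]
            exact div_self_le_one _
      _ = L.card := by simp
  have h3 : ∑ z ∈ Z, ∑ l ∈ L with On z l, (1 / (deg L z : ℝ)) ≤ Z.card := by
    calc _ ≤ ∑ z ∈ Z, (1 : ℝ) := Finset.sum_le_sum fun z _ => by
            rw [Finset.sum_const, nsmul_eq_mul]
            rw [mul_one_div]
            exact div_self_le_one _
      _ = Z.card := by simp
  have h4 : 3 * i ≤ W * (Z.card * L.card / i ^ 2) + i / L.card * L.card +
      i / Z.card * Z.card := by
    rw [← h1]
    refine key.trans ?_
    rw [hW]
    simp only [Finset.sum_add_distrib, Finset.sum_mul]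
    refine add_le_add (add_le_add le_rfl ?_) ?_
    · simp only [← Finset.mul_sum]
      gcongr
    · simp only [← Finset.mul_sum]
      gcongr
  rw [div_mul_cancel₀ _ hL.ne', div_mul_cancel₀ _ hZ.ne'] at h4
  have h5 : i ≤ W * (Z.card * L.card / i ^ 2) := by linarith
  calc i ^ 3 = i * i ^ 2 := by ring
    _ ≤ W * (Z.card * L.card / i ^ 2) * i ^ 2 := by gcongr
    _ = Z.card * L.card * W := by field_simp

end Reduction

end

section

section Paths

variable {F : Type*} [Field F] [DecidableEq F]

/-- The number of triples `(l₀, z, l)` such that `l₀` joins `z₀` and `z ≠ z₀`, and `l` passes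
through `z`. -/
def paths (Z L : Finset (F × F)) (z₀ : F × F) : ℕ :=
  ((L ×ˢ Z ×ˢ L).filter fun q =>
    On z₀ q.1 ∧ On q.2.1 q.1 ∧ q.2.1 ≠ z₀ ∧ On q.2.1 q.2.2).card

theorem sum_rich_mul_deg_le {Z L : Finset (F × F)} (hr : ∀ l ∈ L, 2 ≤ rich Z l) :
    ∑ z ∈ Z, ∑ l ∈ L with On z l, rich Z l * deg L z ≤ 2 * ∑ z ∈ Z, paths Z L z := by
  have h1 : ∑ z₀ ∈ Z, paths Z L z₀ = ∑ q ∈ L ×ˢ Z ×ˢ L, (Z.filter fun z₀ =>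
      On z₀ q.1 ∧ On q.2.1 q.1 ∧ q.2.1 ≠ z₀ ∧ On q.2.1 q.2.2).card :=
    Finset.sum_card_bipartiteAbove_eq_sum_card_bipartiteBelow _
  rw [h1, Finset.sum_product, Finset.mul_sum]
  simp only [Finset.sum_filter]
  rw [Finset.sum_comm]
  refine Finset.sum_le_sum fun l₀ hl₀ => ?_
  rw [Finset.sum_product, Finset.mul_sum]
  refine Finset.sum_le_sum fun z hz => ?_
  split_ifs with h0
  · rw [deg, Finset.card_filter, Finset.mul_sum, Finset.mul_sum]
    refine Finset.sum_le_sum fun l _ => ?_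
    split_ifs with h
    · have h2 : (Z.filter fun z₀ => On z₀ l₀ ∧ On z l₀ ∧ z ≠ z₀ ∧ On z l) =
          (Z.filter fun z₀ => On z₀ l₀).erase z := by
        ext z₀
        simp only [Finset.mem_filter, Finset.mem_erase]
        constructor
        · rintro ⟨a, b, -, c, -⟩
          exact ⟨c.symm, a, b⟩
        · rintro ⟨c, a, b⟩
          exact ⟨a, b, h0, c.symm, h⟩
      have h3 := hr l₀ hl₀
      rw [h2, Finset.card_erase_of_mem (Finset.mem_filter.2 ⟨hz, h0⟩)]
      rw [rich] at h3 ⊢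
      omega
    · simp
  · simp

theorem paths_le_hits {Z L : Finset (F × F)} {Y : Finset F} (hY : ∀ z ∈ Z, z.2 ∈ Y) (z₀ : F × F) :
    paths Z L z₀ ≤ hits (Y.image fun y => (y - z₀.2)⁻¹)
      (L.image fun l => (l.2 + l.1 * z₀.2 - z₀.1, l.1)) ((L.filter fun l => On z₀ l).image Prod.fst) := by
  obtain ⟨x₀, y₀⟩ := z₀
  have hne : ∀ {x y a b : F}, x₀ = a * y₀ + b → x = a * y + b → ((x, y) : F × F) ≠ (x₀, y₀) →
      y - y₀ ≠ 0 := by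
    rintro x y a b h0 h1 h2 h
    refine h2 ?_
    rw [sub_eq_zero.1 h] at h1 ⊢
    rw [h1, h0]
  refine Finset.card_le_card_of_injOn
    (fun q => ((q.2.1.2 - y₀)⁻¹, (q.2.2.2 + q.2.2.1 * y₀ - x₀, q.2.2.1))) ?_ ?_
  · rintro ⟨⟨a₀, b₀⟩, ⟨x, y⟩, ⟨a, b⟩⟩ hq
    simp only [Finset.coe_filter, Finset.mem_product, Set.mem_ofPred_eq, On] at hq
    obtain ⟨⟨hl₀, hz, hl⟩, h0, h1, h2, h3⟩ := hq
    have hy := hne h0 h1 h2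
    refine Finset.mem_coe.2 (Finset.mem_filter.2 ⟨Finset.mem_product.2
      ⟨Finset.mem_image_of_mem (fun y => (y - y₀)⁻¹) (hY _ hz),
        Finset.mem_image_of_mem (fun l : F × F => (l.2 + l.1 * y₀ - x₀, l.1)) hl⟩,
      Finset.mem_image.2 ⟨(a₀, b₀), Finset.mem_filter.2 ⟨hl₀, h0⟩, ?_⟩⟩)
    simp only
    field_simp
    linear_combination h0 - h1 + h3
  · rintro ⟨⟨a₀, b₀⟩, ⟨x, y⟩, ⟨a, b⟩⟩ hq ⟨⟨a₀', b₀'⟩, ⟨x', y'⟩, ⟨a', b'⟩⟩ hq' h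
    simp only [Finset.coe_filter, Finset.mem_product, Set.mem_ofPred_eq, On] at hq hq'
    obtain ⟨-, h0, h1, h2, h3⟩ := hq
    obtain ⟨-, h0', h1', h2', h3'⟩ := hq'
    simp only [Prod.mk.injEq, inv_inj, sub_left_inj] at h
    obtain ⟨rfl, hb, rfl⟩ := h
    rw [add_left_inj] at hb
    subst hb
    have hy := hne h0 h1 h2
    have hx : x = x' := h3.trans h3'.symm
    subst hx
    have ha : a₀ = a₀' := by
      apply mul_right_cancel₀ hy
      linear_combination h0 - h1 + h1' - h0'
    subst ha
    have hb : b₀ = b₀' := by linear_combination h0' - h0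
    rw [hb]

end Paths

theorem sum_rpow_half_le {ι : Type*} (s : Finset ι) (f : ι → ℝ) (hf : ∀ x ∈ s, 0 ≤ f x) :
    ∑ x ∈ s, f x ^ (1 / 2 : ℝ) ≤ (s.card * ∑ x ∈ s, f x) ^ (1 / 2 : ℝ) := by
  rw [← Real.sqrt_eq_rpow]
  apply Real.le_sqrt_of_sq_le
  refine sq_sum_le_card_mul_sum_sq.trans_eq ?_
  congr 1
  refine Finset.sum_congr rfl fun x hx => ?_
  rw [← Real.sqrt_eq_rpow, Real.sq_sqrt (hf x hx)]

theorem sum_rpow_three_quarters_le {ι : Type*} (s : Finset ι) (f : ι → ℝ)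
    (hf : ∀ x ∈ s, 0 ≤ f x) :
    ∑ x ∈ s, f x ^ (3 / 4 : ℝ) ≤
      (s.card : ℝ) ^ (1 / 4 : ℝ) * (∑ x ∈ s, f x) ^ (3 / 4 : ℝ) := by
  have h := Real.inner_le_Lp_mul_Lq_of_nonneg s (f := fun _ => (1 : ℝ))
    (g := fun x => f x ^ (3 / 4 : ℝ)) (p := 4) (q := 4 / 3)
    ⟨by norm_num, by norm_num, by norm_num⟩ (fun _ _ => zero_le_one)
    (fun x hx => Real.rpow_nonneg (hf x hx) _)
  simp only [one_mul, Real.one_rpow, Finset.sum_const, nsmul_eq_mul, mul_one] at h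
  rw [show (1 / (4 / 3) : ℝ) = 3 / 4 by norm_num] at h
  refine h.trans_eq ?_
  congr 2
  refine Finset.sum_congr rfl fun x hx => ?_
  rw [← Real.rpow_mul (hf x hx)]
  norm_num

section Main

variable {p : ℕ} [Fact p.Prime]

theorem sum_paths_le {Z L : Finset (ZMod p × ZMod p)} {Y : Finset (ZMod p)}
    (hY : ∀ z ∈ Z, z.2 ∈ Y) (hYL : Y.card * L.card ≤ p ^ 2) :
    (∑ z ∈ Z, (paths Z L z : ℝ)) ≤ 600 * (
      ((Z.card : ℝ) * inc Z L) ^ (1 / 2 : ℝ) * ((Y.card : ℝ) * L.card) ^ (3 / 4 : ℝ) +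
      inc Z L * ((Y.card : ℝ) * L.card) ^ (1 / 2 : ℝ) +
      ((Z.card : ℝ) * inc Z L) ^ (1 / 2 : ℝ) * (Y.card * (L.card : ℝ) ^ (1 / 2 : ℝ)) +
      Z.card * L.card) := by
  have key : ∀ z ∈ Z, (paths Z L z : ℝ) ≤ 600 * (
      (deg L z : ℝ) ^ (1 / 2 : ℝ) * ((Y.card : ℝ) * L.card) ^ (3 / 4 : ℝ) +
      deg L z * ((Y.card : ℝ) * L.card) ^ (1 / 2 : ℝ) +
      (deg L z : ℝ) ^ (1 / 2 : ℝ) * (Y.card * (L.card : ℝ) ^ (1 / 2 : ℝ)) + L.card) := by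
    intro z _
    set H := Y.image fun y => (y - z.2)⁻¹
    set L' := L.image fun l => (l.2 + l.1 * z.2 - z.1, l.1)
    set D := (L.filter fun l => On z l).image Prod.fst
    have hH : H.card ≤ Y.card := Finset.card_image_le
    have hL : L'.card ≤ L.card := Finset.card_image_le
    have hD : D.card ≤ deg L z := Finset.card_image_le
    have h := hits_le H D L' ((Nat.mul_le_mul hH hL).trans hYL)
    have h' : (paths Z L z : ℝ) ≤ hits H L' D := by exact_mod_cast paths_le_hits hY z
    refine (h'.trans h).trans ?_
    gcongr
  have hinc : (inc Z L : ℝ) = ∑ z ∈ Z, (deg L z : ℝ) := by rw [inc]; push_cast; rfl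
  have s1 := sum_rpow_half_le Z (fun z => (deg L z : ℝ)) fun _ _ => Nat.cast_nonneg _
  rw [← hinc] at s1
  refine (Finset.sum_le_sum key).trans ?_
  rw [← Finset.mul_sum]
  simp only [Finset.sum_add_distrib, ← Finset.sum_mul, ← hinc, Finset.sum_const, nsmul_eq_mul]
  gcongr

theorem sum_paths_le' {Z L : Finset (ZMod p × ZMod p)} {Y : Finset (ZMod p)}
    (hY : ∀ z ∈ Z, z.2 ∈ Y) (hYL : Y.card * L.card ≤ p ^ 2) :
    (∑ z ∈ Z, (paths Z L z : ℝ)) ≤ 600 * (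
      (Y.card : ℝ) ^ (1 / 2 : ℝ) * ((Z.card : ℝ) ^ (1 / 4 : ℝ) * (inc Z L : ℝ) ^ (3 / 4 : ℝ) *
        (L.card : ℝ) ^ (3 / 4 : ℝ)) +
      inc Z L * ((Y.card : ℝ) * L.card) ^ (1 / 2 : ℝ) +
      ((Z.card : ℝ) * inc Z L) ^ (1 / 2 : ℝ) * (Y.card * (L.card : ℝ) ^ (1 / 2 : ℝ)) +
      Z.card * L.card + inc Z L * Y.card) := by
  have key : ∀ z ∈ Z, (paths Z L z : ℝ) ≤ 600 * (
      (Y.card : ℝ) ^ (1 / 2 : ℝ) * ((deg L z : ℝ) ^ (3 / 4 : ℝ) * (L.card : ℝ) ^ (3 / 4 : ℝ)) +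
      deg L z * ((Y.card : ℝ) * L.card) ^ (1 / 2 : ℝ) +
      (deg L z : ℝ) ^ (1 / 2 : ℝ) * (Y.card * (L.card : ℝ) ^ (1 / 2 : ℝ)) + L.card +
      deg L z * Y.card) := by
    intro z _
    set H := Y.image fun y => (y - z.2)⁻¹
    set L' := L.image fun l => (l.2 + l.1 * z.2 - z.1, l.1)
    set D := (L.filter fun l => On z l).image Prod.fst
    have hH : H.card ≤ Y.card := Finset.card_image_le
    have hL : L'.card ≤ L.card := Finset.card_image_le
    have hD : D.card ≤ deg L z := Finset.card_image_le
    have h := hits_le' H D L' ((Nat.mul_le_mul hH hL).trans hYL)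
    have h' : (paths Z L z : ℝ) ≤ hits H L' D := by exact_mod_cast paths_le_hits hY z
    refine (h'.trans h).trans ?_
    rw [← Real.mul_rpow (Nat.cast_nonneg _) (Nat.cast_nonneg _)]
    gcongr
  have hinc : (inc Z L : ℝ) = ∑ z ∈ Z, (deg L z : ℝ) := by rw [inc]; push_cast; rfl
  have s1 := sum_rpow_half_le Z (fun z => (deg L z : ℝ)) fun _ _ => Nat.cast_nonneg _
  have s2 := sum_rpow_three_quarters_le Z (fun z => (deg L z : ℝ)) fun _ _ => Nat.cast_nonneg _
  rw [← hinc] at s1 s2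
  refine (Finset.sum_le_sum key).trans ?_
  rw [← Finset.mul_sum]
  simp only [Finset.sum_add_distrib, ← Finset.sum_mul, ← Finset.mul_sum, ← hinc,
    Finset.sum_const, nsmul_eq_mul]
  gcongr

theorem inc_pow_three_le_mul_sum_paths {F : Type*} [Field F] [DecidableEq F]
    {Z L : Finset (F × F)} (hr : ∀ l ∈ L, 2 ≤ rich Z l) :
    (inc Z L : ℝ) ^ 3 ≤ 2 * (Z.card * L.card) * ∑ z ∈ Z, (paths Z L z : ℝ) := by
  refine (inc_pow_three_le Z L).trans ?_
  have h : ∑ z ∈ Z, ∑ l ∈ L with On z l, (rich Z l : ℝ) * deg L z ≤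
      2 * ∑ z ∈ Z, (paths Z L z : ℝ) := by exact_mod_cast sum_rich_mul_deg_le hr
  calc _ ≤ (Z.card * L.card : ℝ) * (2 * ∑ z ∈ Z, (paths Z L z : ℝ)) := by gcongr
    _ = _ := by ring

end Main

end

section

theorem sq_sum_card_le {α β : Type*} [DecidableEq α] [DecidableEq β] (r : α → β → Prop)
    [∀ a b, Decidable (r a b)] (s : Finset α) (t : Finset β)
    (h : ∀ a a' b b', r a b → r a b' → r a' b → r a' b' → a = a' ∨ b = b') :
    (∑ a ∈ s, (t.filter (r a)).card) ^ 2 ≤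
      s.card * (∑ a ∈ s, (t.filter (r a)).card + t.card ^ 2) := by
  refine sq_sum_le_card_mul_sum_sq.trans (Nat.mul_le_mul_left _ ?_)
  have h1 : ∀ a, (t.filter (r a)).card ^ 2 =
      (t.filter (r a)).card + (t.filter (r a)).offDiag.card := by
    intro a
    rw [Finset.offDiag_card, sq]
    have := Nat.le_mul_self (t.filter (r a)).card
    omega
  simp only [h1, Finset.sum_add_distrib]
  refine Nat.add_le_add_left ?_ _
  rw [← Finset.card_biUnion, sq, ← Finset.card_product]
  · refine Finset.card_le_card fun q hq => ?_
    obtain ⟨a, -, hq⟩ := Finset.mem_biUnion.1 hq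
    rw [Finset.mem_offDiag] at hq
    exact Finset.mem_product.2 ⟨(Finset.mem_filter.1 hq.1).1, (Finset.mem_filter.1 hq.2.1).1⟩
  · refine fun a _ a' _ hne => Finset.disjoint_left.2 fun q hq hq' => ?_
    rw [Finset.mem_offDiag] at hq hq'
    rcases h a a' q.1 q.2 (Finset.mem_filter.1 hq.1).2 (Finset.mem_filter.1 hq.2.1).2
      (Finset.mem_filter.1 hq'.1).2 (Finset.mem_filter.1 hq'.2.1).2 with h | h
    · exact hne h
    · exact hq.2.2 h

theorem le_of_sq_le_mul_add {i a b : ℕ} (h : i ^ 2 ≤ a * (i + b ^ 2)) :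
    (i : ℝ) ≤ b * (a : ℝ) ^ (1 / 2 : ℝ) + a := by
  have h' : (i : ℝ) ^ 2 ≤ a * (i + b ^ 2) := by exact_mod_cast h
  rw [← Real.sqrt_eq_rpow]
  have ha : √(a : ℝ) ^ 2 = a := Real.sq_sqrt (Nat.cast_nonneg _)
  have hs := Real.sqrt_nonneg (a : ℝ)
  have hb : (0 : ℝ) ≤ b := Nat.cast_nonneg _
  have ha0 : (0 : ℝ) ≤ a := Nat.cast_nonneg _
  by_contra! hlt
  have hbs : 0 ≤ b * √(a : ℝ) := by positivity
  have e : (a : ℝ) * b ^ 2 = (b * √(a : ℝ)) ^ 2 := by rw [mul_pow, ha]; ring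
  rw [mul_add, e] at h'
  nlinarith

section Trivial

variable {F : Type*} [Field F] [DecidableEq F]

theorem eq_or_eq_of_on {z z' l l' : F × F} (h₁ : On z l) (h₂ : On z l') (h₃ : On z' l)
    (h₄ : On z' l') : z = z' ∨ l = l' := by
  obtain ⟨x, y⟩ := z
  obtain ⟨x', y'⟩ := z'
  obtain ⟨a, b⟩ := l
  obtain ⟨a', b'⟩ := l'
  simp only [On] at h₁ h₂ h₃ h₄
  by_cases hy : y = y'
  · subst hy
    exact Or.inl (by rw [h₁, h₃])
  · right
    have ha : a = a' := by
      apply mul_right_cancel₀ (sub_ne_zero.2 hy)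
      linear_combination h₂ - h₁ + h₃ - h₄
    subst ha
    rw [add_left_cancel (h₁.symm.trans h₂)]

theorem inc_le_left (Z L : Finset (F × F)) :
    (inc Z L : ℝ) ≤ L.card * (Z.card : ℝ) ^ (1 / 2 : ℝ) + Z.card :=
  le_of_sq_le_mul_add (sq_sum_card_le On Z L fun _ _ _ _ h₁ h₂ h₃ h₄ =>
    eq_or_eq_of_on h₁ h₂ h₃ h₄)

theorem inc_le_right (Z L : Finset (F × F)) :
    (inc Z L : ℝ) ≤ Z.card * (L.card : ℝ) ^ (1 / 2 : ℝ) + L.card := by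
  rw [inc_eq_sum_rich]
  exact le_of_sq_le_mul_add (sq_sum_card_le (fun l z => On z l) L Z
    fun _ _ _ _ h₁ h₂ h₃ h₄ => (eq_or_eq_of_on h₁ h₃ h₂ h₄).symm)

end Trivial

/-- The sum of the four terms common to both bounds. -/
noncomputable def restTerms (X Y L Z : ℝ) : ℝ :=
  Y * X ^ (1 / 2 : ℝ) * L ^ (1 / 2 : ℝ) + Z ^ (2 / 3 : ℝ) * L ^ (2 / 3 : ℝ) + L + Z

section Optimization

open Real

theorem exists_exp_eq {x : ℝ} (hx : 1 ≤ x) : ∃ t, 0 ≤ t ∧ exp t = x :=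
  ⟨log x, log_nonneg hx, exp_log (by linarith)⟩

theorem exp_lt_of_add_lt {k a i s : ℝ} (hi : exp k * s < exp i) (ha : exp a ≤ s) : k + a < i := by
  rw [← exp_lt_exp, exp_add]
  exact (mul_le_mul_of_nonneg_left ha (exp_pos k).le).trans_lt hi

theorem add_lt_of_exp_mul_sum_lt {k i b r₁ r₂ r₃ r₄ : ℝ}
    (h : exp k * (exp b + (exp r₁ + exp r₂ + exp r₃ + exp r₄)) < exp i) :
    k + b < i ∧ k + r₁ < i ∧ k + r₂ < i ∧ k + r₃ < i ∧ k + r₄ < i := by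
  have p := exp_pos b
  have p₁ := exp_pos r₁
  have p₂ := exp_pos r₂
  have p₃ := exp_pos r₃
  have p₄ := exp_pos r₄
  refine ⟨?_, ?_, ?_, ?_, ?_⟩ <;> exact exp_lt_of_add_lt h (by linarith)

theorem le_of_exp_le_add {c i a b : ℝ} (hc : 2 ≤ exp c) (h : exp i ≤ exp a + exp b)
    (hb : c + b < i) : i ≤ c + a := by
  rw [← exp_le_exp, exp_add]
  rw [← exp_lt_exp, exp_add] at hb
  nlinarith [exp_pos a, exp_pos b]

theorem exists_of_exp_le_sum {c j q a₁ a₂ a₃ a₄ a₅ : ℝ} (hc : exp c = 6000)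
    (h : exp j ≤ 2 * exp q * (600 * (exp a₁ + exp a₂ + exp a₃ + exp a₄ + exp a₅))) :
    j ≤ c + q + a₁ ∨ j ≤ c + q + a₂ ∨ j ≤ c + q + a₃ ∨ j ≤ c + q + a₄ ∨ j ≤ c + q + a₅ := by
  by_contra! hlt
  obtain ⟨h₁, h₂, h₃, h₄, h₅⟩ := hlt
  rw [← exp_lt_exp, exp_add, exp_add, hc] at h₁ h₂ h₃ h₄ h₅
  linarith

theorem exists_of_exp_le_sum' {c j q a₁ a₂ a₃ a₄ : ℝ} (hc : exp c = 6000)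
    (h : exp j ≤ 2 * exp q * (600 * (exp a₁ + exp a₂ + exp a₃ + exp a₄))) :
    j ≤ c + q + a₁ ∨ j ≤ c + q + a₂ ∨ j ≤ c + q + a₃ ∨ j ≤ c + q + a₄ := by
  by_contra! hlt
  obtain ⟨h₁, h₂, h₃, h₄⟩ := hlt
  rw [← exp_lt_exp, exp_add, exp_add, hc] at h₁ h₂ h₃ h₄
  linarith [exp_pos j]

variable {X Y L Z i : ℝ}

theorem le_of_pow_three_le (hX : 1 ≤ X) (hY : 1 ≤ Y) (hL : 1 ≤ L) (hZ : 1 ≤ Z) (hi : 0 ≤ i)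
    (hXY : Z ≤ X * Y) (t₁ : i ≤ L * Z ^ (1 / 2 : ℝ) + Z) (t₂ : i ≤ Z * L ^ (1 / 2 : ℝ) + L)
    (h : i ^ 3 ≤ 2 * (Z * L) * (600 * ((Z * i) ^ (1 / 2 : ℝ) * (Y * L) ^ (3 / 4 : ℝ) +
      i * (Y * L) ^ (1 / 2 : ℝ) + (Z * i) ^ (1 / 2 : ℝ) * (Y * L ^ (1 / 2 : ℝ)) + Z * L))) :
    i ≤ 6000 ^ 10 * (Y ^ (9 / 10 : ℝ) * X ^ (3 / 5 : ℝ) * L ^ (7 / 10 : ℝ) +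
      restTerms X Y L Z) := by
  by_contra! hlt
  have hi0 : 0 < i := lt_of_le_of_lt (by unfold restTerms; positivity) hlt
  obtain ⟨x, hx, rfl⟩ := exists_exp_eq hX
  obtain ⟨y, hy, rfl⟩ := exists_exp_eq hY
  obtain ⟨l, hl, rfl⟩ := exists_exp_eq hL
  obtain ⟨z, hz, rfl⟩ := exists_exp_eq hZ
  obtain ⟨j, rfl⟩ : ∃ j, exp j = i := ⟨log i, exp_log hi0⟩
  obtain ⟨c, hc, hc'⟩ := exists_exp_eq (show (1 : ℝ) ≤ 6000 by norm_num)
  rw [← hc', ← exp_nat_mul] at hlt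
  simp only [restTerms, ← exp_mul, ← exp_add, ← exp_nat_mul] at hlt hXY t₁ t₂ h
  rw [exp_le_exp] at hXY
  obtain ⟨b, r₁, r₂, r₃, r₄⟩ := add_lt_of_exp_mul_sum_lt hlt
  push_cast at b r₁ r₂ r₃ r₄
  have t₁ := le_of_exp_le_add (c := c) (by linarith) t₁ (by linarith)
  have t₂ := le_of_exp_le_add (c := c) (by linarith) t₂ (by linarith)
  rcases exists_of_exp_le_sum' hc' h with h | h | h | h <;> push_cast at h
  · linarith
  · linarith
  · rcases le_total y l with hyl | hyl <;> linarith
  · linarith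

theorem le_of_pow_three_le' (hX : 1 ≤ X) (hY : 1 ≤ Y) (hL : 1 ≤ L) (hZ : 1 ≤ Z) (hi : 0 ≤ i)
    (hXY : Z ≤ X * Y) (t₁ : i ≤ L * Z ^ (1 / 2 : ℝ) + Z)
    (h : i ^ 3 ≤ 2 * (Z * L) * (600 * (
      Y ^ (1 / 2 : ℝ) * (Z ^ (1 / 4 : ℝ) * i ^ (3 / 4 : ℝ) * L ^ (3 / 4 : ℝ)) +
      i * (Y * L) ^ (1 / 2 : ℝ) + (Z * i) ^ (1 / 2 : ℝ) * (Y * L ^ (1 / 2 : ℝ)) + Z * L +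
      i * Y))) :
    i ≤ 6000 ^ 10 * (Y ^ (7 / 9 : ℝ) * X ^ (5 / 9 : ℝ) * L ^ (7 / 9 : ℝ) +
      restTerms X Y L Z) := by
  by_contra! hlt
  have hi0 : 0 < i := lt_of_le_of_lt (by unfold restTerms; positivity) hlt
  obtain ⟨x, hx, rfl⟩ := exists_exp_eq hX
  obtain ⟨y, hy, rfl⟩ := exists_exp_eq hY
  obtain ⟨l, hl, rfl⟩ := exists_exp_eq hL
  obtain ⟨z, hz, rfl⟩ := exists_exp_eq hZ
  obtain ⟨j, rfl⟩ : ∃ j, exp j = i := ⟨log i, exp_log hi0⟩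
  obtain ⟨c, hc, hc'⟩ := exists_exp_eq (show (1 : ℝ) ≤ 6000 by norm_num)
  rw [← hc', ← exp_nat_mul] at hlt
  simp only [restTerms, ← exp_mul, ← exp_add, ← exp_nat_mul] at hlt hXY t₁ h
  rw [exp_le_exp] at hXY
  obtain ⟨b, r₁, r₂, r₃, r₄⟩ := add_lt_of_exp_mul_sum_lt hlt
  push_cast at b r₁ r₂ r₃ r₄
  have t₁ := le_of_exp_le_add (c := c) (by linarith) t₁ (by linarith)
  rcases exists_of_exp_le_sum hc' h with h | h | h | h | h <;> push_cast at h
  · linarith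
  · linarith
  · rcases le_total (x + 5 * y) (4 * l) with hyl | hyl <;> linarith
  · linarith
  · linarith

end Optimization

end

section

theorem min_add_restTerms_mono {X Y L L' Z : ℝ} (hX : 0 ≤ X) (hY : 0 ≤ Y) (hL : 0 ≤ L)
    (hZ : 0 ≤ Z) (h : L ≤ L') :
    min (Y ^ (9 / 10 : ℝ) * X ^ (3 / 5 : ℝ) * L ^ (7 / 10 : ℝ))
      (Y ^ (7 / 9 : ℝ) * X ^ (5 / 9 : ℝ) * L ^ (7 / 9 : ℝ)) + restTerms X Y L Z ≤
    min (Y ^ (9 / 10 : ℝ) * X ^ (3 / 5 : ℝ) * L' ^ (7 / 10 : ℝ))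
      (Y ^ (7 / 9 : ℝ) * X ^ (5 / 9 : ℝ) * L' ^ (7 / 9 : ℝ)) + restTerms X Y L' Z := by
  unfold restTerms
  gcongr

section Counting

variable {p : ℕ} [Fact p.Prime]

theorem inc_le_of_two_le_rich {Z L : Finset (ZMod p × ZMod p)} {Y : Finset (ZMod p)} {X : ℕ}
    (hX : 0 < X) (hY : ∀ z ∈ Z, z.2 ∈ Y) (hZ : Z.card ≤ X * Y.card)
    (hYL : Y.card * L.card ≤ p ^ 2) (hr : ∀ l ∈ L, 2 ≤ rich Z l) :
    (inc Z L : ℝ) ≤ 6000 ^ 10 * (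
      min ((Y.card : ℝ) ^ (9 / 10 : ℝ) * (X : ℝ) ^ (3 / 5 : ℝ) * (L.card : ℝ) ^ (7 / 10 : ℝ))
        ((Y.card : ℝ) ^ (7 / 9 : ℝ) * (X : ℝ) ^ (5 / 9 : ℝ) * (L.card : ℝ) ^ (7 / 9 : ℝ)) +
      restTerms X Y.card L.card Z.card) := by
  rcases Nat.eq_zero_or_pos (inc Z L) with h0 | hpos
  · rw [h0, Nat.cast_zero, restTerms]
    positivity
  have hZ1 : 1 ≤ Z.card := by
    rw [Nat.one_le_iff_ne_zero, Ne, Finset.card_eq_zero]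
    rintro rfl
    simp [inc] at hpos
  have hL1 : 1 ≤ L.card := by
    rw [Nat.one_le_iff_ne_zero, Ne, Finset.card_eq_zero]
    rintro rfl
    simp [inc, deg] at hpos
  have hY1 : 1 ≤ Y.card := Nat.pos_of_ne_zero fun h => by
    rw [h, mul_zero] at hZ
    omega
  have hXY : (Z.card : ℝ) ≤ X * Y.card := by exact_mod_cast hZ
  have h := inc_pow_three_le_mul_sum_paths hr
  have hX' : (1 : ℝ) ≤ X := by exact_mod_cast hX
  have hY' : (1 : ℝ) ≤ Y.card := by exact_mod_cast hY1
  have hL' : (1 : ℝ) ≤ L.card := by exact_mod_cast hL1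
  have hZ' : (1 : ℝ) ≤ Z.card := by exact_mod_cast hZ1
  have hα := le_of_pow_three_le hX' hY' hL' hZ' (Nat.cast_nonneg _) hXY (inc_le_left Z L)
    (inc_le_right Z L) (h.trans (mul_le_mul_of_nonneg_left (sum_paths_le hY hYL) (by positivity)))
  have hβ := le_of_pow_three_le' hX' hY' hL' hZ' (Nat.cast_nonneg _) hXY (inc_le_left Z L)
    (h.trans (mul_le_mul_of_nonneg_left (sum_paths_le' hY hYL) (by positivity)))
  rcases min_choice
    ((Y.card : ℝ) ^ (9 / 10 : ℝ) * (X : ℝ) ^ (3 / 5 : ℝ) * (L.card : ℝ) ^ (7 / 10 : ℝ))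
    ((Y.card : ℝ) ^ (7 / 9 : ℝ) * (X : ℝ) ^ (5 / 9 : ℝ) * (L.card : ℝ) ^ (7 / 9 : ℝ)) with e | e
  · rw [e]
    exact hα
  · rw [e]
    exact hβ

theorem inc_le {Z L : Finset (ZMod p × ZMod p)} {Y : Finset (ZMod p)} {X : ℕ}
    (hX : 0 < X) (hY : ∀ z ∈ Z, z.2 ∈ Y) (hZ : Z.card ≤ X * Y.card)
    (hYL : Y.card * L.card ≤ p ^ 2) :
    (inc Z L : ℝ) ≤ 6000 ^ 10 * (
      min ((Y.card : ℝ) ^ (9 / 10 : ℝ) * (X : ℝ) ^ (3 / 5 : ℝ) * (L.card : ℝ) ^ (7 / 10 : ℝ))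
        ((Y.card : ℝ) ^ (7 / 9 : ℝ) * (X : ℝ) ^ (5 / 9 : ℝ) * (L.card : ℝ) ^ (7 / 9 : ℝ)) +
      restTerms X Y.card L.card Z.card) + L.card := by
  set L' := L.filter fun l => 2 ≤ rich Z l with hL'
  have hc : L'.card ≤ L.card := Finset.card_filter_le _ _
  have hc' : (L'.card : ℝ) ≤ L.card := by exact_mod_cast hc
  have h1 : inc Z L ≤ inc Z L' + L.card := by
    rw [inc_eq_sum_rich, inc_eq_sum_rich, ← Finset.sum_filter_add_sum_filter_not L
      (fun l => 2 ≤ rich Z l)]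
    refine Nat.add_le_add_left ?_ _
    calc _ ≤ ∑ l ∈ L with ¬ 2 ≤ rich Z l, 1 := Finset.sum_le_sum fun l hl => by
            have := (Finset.mem_filter.1 hl).2
            omega
      _ ≤ L.card := by
        rw [Finset.sum_const, smul_eq_mul, mul_one]
        exact Finset.card_filter_le _ _
  have h2 := inc_le_of_two_le_rich hX hY hZ ((Nat.mul_le_mul_left _ hc).trans hYL)
    (fun l hl => (Finset.mem_filter.1 hl).2 : ∀ l ∈ L', 2 ≤ rich Z l)
  have h3 : (inc Z L : ℝ) ≤ inc Z L' + L.card := by exact_mod_cast h1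
  have h4 := mul_le_mul_of_nonneg_left
    (min_add_restTerms_mono X.cast_nonneg Y.card.cast_nonneg L'.card.cast_nonneg
      Z.card.cast_nonneg hc') (by positivity : (0 : ℝ) ≤ 6000 ^ 10)
  linarith

end Counting

section Lines

variable {F : Type*} [Field F]

theorem eq_of_isLine {ℓ : Set (F × F)} (h : IsLine ℓ) :
    (∀ z ∈ ℓ, ℓ = {w | w.2 = z.2}) ∨ ∃ l : F × F, ℓ = {w | On w l} := by
  obtain ⟨a, b, c, hab, rfl⟩ := h
  by_cases ha : a = 0
  · left
    have hb : b ≠ 0 := by tauto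
    intro z hz
    have hz : a * z.1 + b * z.2 = c := hz
    ext w
    change a * w.1 + b * w.2 = c ↔ w.2 = z.2
    rw [← hz, ha, zero_mul, zero_mul, zero_add, zero_add]
    exact ⟨fun h => mul_left_cancel₀ hb h, fun h => by rw [h]⟩
  · right
    refine ⟨(-b / a, c / a), ?_⟩
    ext w
    change a * w.1 + b * w.2 = c ↔ w.1 = -b / a * w.2 + c / a
    constructor
    · intro h
      field_simp
      linear_combination h
    · intro h
      field_simp at h
      linear_combination h

theorem setOf_on_injective : Function.Injective fun l : F × F => {w : F × F | On w l} := by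
  rintro ⟨a, b⟩ ⟨a', b'⟩ h
  have key : ∀ w : F × F, On w (a, b) ↔ On w (a', b') := fun w => Set.ext_iff.1 h w
  have h0 : b = a' * 0 + b' := (key (b, 0)).1 (by simp [On])
  have h1 : a + b = a' * 1 + b' := (key (a + b, 1)).1 (by simp [On])
  have hb : b = b' := by linear_combination h0
  have ha : a = a' := by linear_combination h1 - hb
  rw [ha, hb]

open scoped Classical in
theorem nIncidences_le [Fintype F] {Z : Set (F × F)} {L : Set (Set (F × F))}
    (hL : ∀ ℓ ∈ L, IsLine ℓ) :
    nIncidences Z L ≤ Z.ncard +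
      inc Z.toFinset (Finset.univ.filter fun l : F × F => {w : F × F | On w l} ∈ L) := by
  set L' := Finset.univ.filter fun l : F × F => {w : F × F | On w l} ∈ L with hL'
  set S := (Z.toFinset ×ˢ L').filter fun q => On q.1 q.2 with hS
  have hcard : S.card = inc Z.toFinset L' := by
    rw [hS, Finset.card_filter, Finset.sum_product, inc]
    simp only [deg, Finset.card_filter]
  have hsub : {zl : (F × F) × Set (F × F) | zl.1 ∈ Z ∧ zl.2 ∈ L ∧ zl.1 ∈ zl.2} ⊆
      (fun z : F × F => (z, {w : F × F | w.2 = z.2})) '' Z ∪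
        (fun q : (F × F) × F × F => (q.1, {w : F × F | On w q.2})) ''
          (S : Set ((F × F) × F × F)) := by
    rintro ⟨z, ℓ⟩ ⟨hz, hℓ, hzℓ⟩
    rcases eq_of_isLine (hL ℓ hℓ) with h | ⟨l, h⟩
    · left
      exact ⟨z, hz, by rw [h z hzℓ]⟩
    · right
      refine ⟨(z, l), ?_, by rw [h]⟩
      simp only at hz hℓ hzℓ
      subst h
      exact Finset.mem_coe.2 (Finset.mem_filter.2 ⟨Finset.mem_product.2
        ⟨Set.mem_toFinset.2 hz, Finset.mem_filter.2 ⟨Finset.mem_univ _, hℓ⟩⟩, hzℓ⟩)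
  rw [← hcard, nIncidences]
  calc _ ≤ _ := Set.ncard_le_ncard hsub (Set.toFinite _)
    _ ≤ _ := Set.ncard_union_le _ _
    _ ≤ _ := Nat.add_le_add (Set.ncard_image_le (Set.toFinite _))
      ((Set.ncard_image_le (Set.toFinite _)).trans (Set.ncard_coe_finset S).le)

end Lines

end

end LightRay

/-- the incidence bound for points on a small pencil of horizontal lines:
if $Z = \bigcup_{y \in Y} X_y \times \{y\}$ with each $|X_y| \le X$ and
$|Y||L| \le c p^2$, then
$I(Z,L) \le C(\min(|Y|^{9/10}X^{3/5}|L|^{7/10}, |Y|^{7/9}X^{5/9}|L|^{7/9})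
+ |Y|X^{1/2}|L|^{1/2} + |Z|^{2/3}|L|^{2/3} + |L| + |Z|)$. -/
theorem statement6 :
    ∃ c K : ℝ, 0 < c ∧ 0 < K ∧
      ∀ (p : ℕ) [Fact p.Prime] (X : ℕ) (Y : Set (ZMod p))
        (Xy : ZMod p → Set (ZMod p)) (L : Set (Set (ZMod p × ZMod p)))
        (Z : Set (ZMod p × ZMod p)),
        0 < X →
        (∀ y ∈ Y, (Xy y).ncard ≤ X) →
        Z = ⋃ y ∈ Y, Xy y ×ˢ ({y} : Set (ZMod p)) →
        (∀ ℓ ∈ L, IsLine ℓ) →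
        (Y.ncard : ℝ) * (L.ncard : ℝ) ≤ c * (p : ℝ) ^ (2 : ℕ) →
        (nIncidences Z L : ℝ) ≤
          K * (min ((Y.ncard : ℝ) ^ (9/10 : ℝ) * (X : ℝ) ^ (3/5 : ℝ) * (L.ncard : ℝ) ^ (7/10 : ℝ))
                  ((Y.ncard : ℝ) ^ (7/9 : ℝ) * (X : ℝ) ^ (5/9 : ℝ) * (L.ncard : ℝ) ^ (7/9 : ℝ))
              + (Y.ncard : ℝ) * (X : ℝ) ^ (1/2 : ℝ) * (L.ncard : ℝ) ^ (1/2 : ℝ)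
              + (Z.ncard : ℝ) ^ (2/3 : ℝ) * (L.ncard : ℝ) ^ (2/3 : ℝ)
              + (L.ncard : ℝ) + (Z.ncard : ℝ)) := by
  classical
  refine ⟨1, 6000 ^ 10 + 1, one_pos, by positivity, ?_⟩
  intro p _ X Y Xy L Z hX hXy hZ hL hYL
  set L' := Finset.univ.filter fun l : ZMod p × ZMod p => {w | LightRay.On w l} ∈ L
  have hLc : L'.card ≤ L.ncard := by
    rw [← Set.ncard_coe_finset]
    exact Set.ncard_le_ncard_of_injOn (fun l => {w : ZMod p × ZMod p | LightRay.On w l})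
      (fun l hl => (Finset.mem_filter.1 hl).2) LightRay.setOf_on_injective.injOn (Set.toFinite _)
  have hLc' : (L'.card : ℝ) ≤ L.ncard := by exact_mod_cast hLc
  have hYc : Y.toFinset.card = Y.ncard := (Set.ncard_eq_toFinset_card' Y).symm
  have hZc : Z.toFinset.card = Z.ncard := (Set.ncard_eq_toFinset_card' Z).symm
  have hmem : ∀ z ∈ Z.toFinset, z.2 ∈ Y.toFinset ∧ z.1 ∈ Xy z.2 := by
    intro z hz
    rw [Set.mem_toFinset, hZ] at hz
    simp only [Set.mem_iUnion, Set.mem_prod, Set.mem_singleton_iff, exists_prop] at hz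
    obtain ⟨y, hy, hx, rfl⟩ := hz
    exact ⟨Set.mem_toFinset.2 hy, hx⟩
  have hZX : Z.toFinset.card ≤ X * Y.toFinset.card := by
    refine Finset.card_le_mul_card_image_of_maps_to (f := Prod.snd) (fun z hz => (hmem z hz).1) X ?_
    intro y hy
    refine le_trans ?_ (hXy y (Set.mem_toFinset.1 hy))
    rw [← Set.ncard_coe_finset]
    refine Set.ncard_le_ncard_of_injOn Prod.fst ?_ ?_ (Set.toFinite _)
    · intro z hz
      obtain ⟨hzZ, rfl⟩ := Finset.mem_filter.1 hz
      exact (hmem z hzZ).2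
    · intro z hz z' hz' h
      exact Prod.ext h ((Finset.mem_filter.1 hz).2.trans (Finset.mem_filter.1 hz').2.symm)
  have hYL' : Y.toFinset.card * L'.card ≤ p ^ 2 := by
    rw [hYc]
    refine (Nat.mul_le_mul_left _ hLc).trans ?_
    rw [one_mul] at hYL
    exact_mod_cast hYL
  have h1 := LightRay.inc_le hX (fun z hz => (hmem z hz).1) hZX hYL'
  have h2 : (nIncidences Z L : ℝ) ≤ Z.ncard + LightRay.inc Z.toFinset L' := by
    have := LightRay.nIncidences_le (Z := Z) hL
    exact_mod_cast (by convert this)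
  rw [hYc, hZc] at h1
  have h3 := mul_le_mul_of_nonneg_left
    (LightRay.min_add_restTerms_mono X.cast_nonneg Y.ncard.cast_nonneg L'.card.cast_nonneg
      Z.ncard.cast_nonneg hLc') (by positivity : (0 : ℝ) ≤ 6000 ^ 10)
  have h4 := h2.trans (add_le_add le_rfl (h1.trans (add_le_add h3 hLc')))
  set M : ℝ := min ((Y.ncard : ℝ) ^ (9 / 10 : ℝ) * (X : ℝ) ^ (3 / 5 : ℝ) *
    (L.ncard : ℝ) ^ (7 / 10 : ℝ)) ((Y.ncard : ℝ) ^ (7 / 9 : ℝ) * (X : ℝ) ^ (5 / 9 : ℝ) *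
    (L.ncard : ℝ) ^ (7 / 9 : ℝ))
  have hM0 : 0 ≤ M := by positivity
  have h5 : 0 ≤ (Y.ncard : ℝ) * (X : ℝ) ^ (1 / 2 : ℝ) * (L.ncard : ℝ) ^ (1 / 2 : ℝ) := by
    positivity
  have h6 : 0 ≤ (Z.ncard : ℝ) ^ (2 / 3 : ℝ) * (L.ncard : ℝ) ^ (2 / 3 : ℝ) := by positivity
  rw [LightRay.restTerms] at h4
  linarith
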